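/- arXiv:2309.03030 — 13 statements merged into one kernel-verified Lean document; each statement's English description precedes it below -/
import Mathlib

section
/- Let Γ = G *_φ H be the free product of groups G and H with subgroups A ≤ G and B ≤ H amalgamated via an isomorphism φ : A → B. Let G' ≤ G and H' ≤ H be subgroups such that, with A' = G' ∩ A and B' = H' ∩ B, one has φ(A') = B', and let φ' : A' → B' be the restriction of φ. Then the subgroup Γ' = ⟨G', H'⟩ of Γ generated by the canonical images of G' and H' is naturally isomorphic to the amalgamated free product G' *_{φ'} H'; that is, the canonical homomorphism G' *_{φ'} H' → Γ is injective with image Γ'. -/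
open Monoid

/-- The free product of `G` and `H` with amalgamation along the homomorphisms
`i : A →* G` and `j : A →* H`: the quotient of the free product `G * H` by the
normal closure of the elements `j a * (i a)⁻¹`. -/
abbrev Amalg {A G H : Type} [Group A] [Group G] [Group H] (i : A →* G) (j : A →* H) : Type :=
  (Coprod G H) ⧸ Subgroup.normalClosure
    {x : Coprod G H | ∃ a : A, x = Coprod.inr (j a) * (Coprod.inl (i a))⁻¹}

/-- The canonical homomorphism of `G` into the amalgamated product. -/
def Amalg.inl {A G H : Type} [Group A] [Group G] [Group H] (i : A →* G) (j : A →* H) :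
    G →* Amalg i j :=
  (QuotientGroup.mk' _).comp Coprod.inl

/-- The canonical homomorphism of `H` into the amalgamated product. -/
def Amalg.inr {A G H : Type} [Group A] [Group G] [Group H] (i : A →* G) (j : A →* H) :
    H →* Amalg i j :=
  (QuotientGroup.mk' _).comp Coprod.inr

namespace AmalgAux

open Monoid Monoid.PushoutI Function

section General

variable {ι : Type} {G G' : ι → Type} {H H' : Type} [∀ i, Group (G i)] [∀ i, Group (G' i)]
  [Group H] [Group H'] {φ : ∀ i, H →* G i} {φ' : ∀ i, H' →* G' i}

/-- The map of pushouts induced by a morphism of diagrams. -/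
def pmap (f : ∀ i, G' i →* G i) (k : H' →* H)
    (hk : ∀ i, (f i).comp (φ' i) = (φ i).comp k) : PushoutI φ' →* PushoutI φ :=
  PushoutI.lift (fun i => (PushoutI.of i).comp (f i)) ((PushoutI.base φ).comp k) (by
    intro i
    rw [MonoidHom.comp_assoc, hk, ← MonoidHom.comp_assoc, PushoutI.of_comp_eq_base])

theorem pmap_of (f : ∀ i, G' i →* G i) (k : H' →* H)
    (hk : ∀ i, (f i).comp (φ' i) = (φ i).comp k) (i : ι) (x : G' i) :
    pmap f k hk (PushoutI.of i x) = PushoutI.of i (f i x) := by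
  simp [pmap]

theorem eq_one_of_mem_range (d : NormalWord.Transversal φ') (i : ι) (g : G' i)
    (hg : g ∈ d.set i) (hr : g ∈ (φ' i).range) : g = 1 := by
  have h := (d.compl i).1 (a₁ := (⟨g, hr⟩, ⟨1, d.one_mem i⟩))
    (a₂ := (⟨1, one_mem _⟩, ⟨g, hg⟩)) (by simp)
  have := congrArg (fun x => (x.1 : G' i)) h
  simpa using this

theorem pmap_injective (f : ∀ i, G' i →* G i) (k : H' →* H)
    (hk : ∀ i, (f i).comp (φ' i) = (φ i).comp k)
    (hφ : ∀ i, Injective (φ i)) (hφ' : ∀ i, Injective (φ' i))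
    (hf : ∀ i, Injective (f i)) (hkinj : Injective k)
    (hr : ∀ i g, f i g ∈ (φ i).range → g ∈ (φ' i).range) :
    Injective (pmap f k hk) := by
  classical
  rw [injective_iff_map_eq_one]
  intro x hx
  obtain ⟨d⟩ := NormalWord.transversal_nonempty φ' hφ'
  obtain ⟨w, rfl⟩ : ∃ w : NormalWord d, w.prod = x :=
    ⟨NormalWord.equiv x, NormalWord.equiv.symm_apply_apply x⟩
  let W : CoprodI.Word G :=
    { toList := w.toList.map (fun l => ⟨l.1, f l.1 l.2⟩)
      ne_one := by
        intro l hl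
        obtain ⟨l', hl', rfl⟩ := List.mem_map.1 hl
        intro h
        exact w.ne_one l' hl' ((map_eq_one_iff (f l'.1) (hf l'.1)).1 h)
      chain_ne := by
        rw [List.isChain_map]
        exact w.chain_ne }
  have hW : Reduced φ W := by
    intro l hl hmem
    obtain ⟨l', hl', rfl⟩ := List.mem_map.1 hl
    exact w.ne_one l' hl'
      (eq_one_of_mem_range d l'.1 l'.2 (w.normalized l'.1 l'.2 hl') (hr _ _ hmem))
  have hprod : pmap f k hk (ofCoprodI w.toWord.prod) = ofCoprodI W.prod := by
    simp only [CoprodI.Word.prod, map_list_prod, W, List.map_map]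
    refine congrArg List.prod (List.map_congr_left ?_)
    intro l _
    simp [pmap]
  have hx' : base φ (k w.head) * ofCoprodI W.prod = 1 := by
    rw [← hprod, ← hx, NormalWord.prod, map_mul]
    simp [pmap]
  have hWe : W = .empty := by
    apply hW.eq_empty_of_mem_range hφ
    rw [← inv_eq_of_mul_eq_one_right hx']
    exact inv_mem ⟨_, rfl⟩
  have hl : w.toList = [] := by
    have := congrArg CoprodI.Word.toList hWe
    simpa [W, CoprodI.Word.empty] using this
  rw [hWe] at hx'
  have h1 : w.head = 1 := by
    apply hkinj
    apply base_injective hφ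
    simpa using hx'
  have : w = NormalWord.empty := NormalWord.ext h1 hl
  rw [this, NormalWord.prod_empty]

end General

/-- The two-element family. -/
def Fam (G H : Type) : Bool → Type
  | true => G
  | false => H

instance (G H : Type) [Group G] [Group H] : ∀ b, Group (Fam G H b)
  | true => inferInstanceAs (Group G)
  | false => inferInstanceAs (Group H)

/-- The two-element diagram. -/
def fmap {A G H : Type} [Group A] [Group G] [Group H] (i : A →* G) (j : A →* H) :
    ∀ b, A →* Fam G H b
  | true => i
  | false => j

/-- Morphism of the families. -/
def fmor {G H G' H' : Type} [Group G] [Group H] [Group G'] [Group H']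
    (f : G' →* G) (g : H' →* H) : ∀ b, Fam G' H' b →* Fam G H b
  | true => f
  | false => g

section

variable {A G H K : Type} [Group A] [Group G] [Group H] [Group K] (i : A →* G) (j : A →* H)

theorem amalg_glue (a : A) : Amalg.inl i j (i a) = Amalg.inr i j (j a) := by
  have h : ((Coprod.inr (j a) * (Coprod.inl (i a))⁻¹ : Coprod G H) : Amalg i j) = 1 :=
    (QuotientGroup.eq_one_iff _).2 (Subgroup.subset_normalClosure ⟨a, rfl⟩)
  rw [QuotientGroup.mk_mul, QuotientGroup.mk_inv, mul_inv_eq_one] at h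
  exact h.symm

/-- Universal property. -/
def alift (f : G →* K) (g : H →* K) (h : ∀ a, f (i a) = g (j a)) : Amalg i j →* K :=
  QuotientGroup.lift _ (Coprod.lift f g) (by
    intro x hx
    have : Subgroup.normalClosure
      {x : Coprod G H | ∃ a : A, x = Coprod.inr (j a) * (Coprod.inl (i a))⁻¹} ≤
        (Coprod.lift f g).ker := by
      apply Subgroup.normalClosure_le_normal
      rintro _ ⟨a, rfl⟩
      simp [MonoidHom.mem_ker, h]
    exact this hx)

theorem alift_inl (f : G →* K) (g : H →* K) (h : ∀ a, f (i a) = g (j a)) (x : G) :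
    alift i j f g h (Amalg.inl i j x) = f x := by
  simp [alift, Amalg.inl]

theorem alift_inr (f : G →* K) (g : H →* K) (h : ∀ a, f (i a) = g (j a)) (x : H) :
    alift i j f g h (Amalg.inr i j x) = g x := by
  simp [alift, Amalg.inr]

theorem amalg_ext {i : A →* G} {j : A →* H} {f g : Amalg i j →* K}
    (h1 : ∀ x, f (Amalg.inl i j x) = g (Amalg.inl i j x))
    (h2 : ∀ x, f (Amalg.inr i j x) = g (Amalg.inr i j x)) : f = g := by
  apply QuotientGroup.monoidHom_ext
  apply Coprod.hom_ext
  · ext x; exact h1 x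
  · ext x; exact h2 x

theorem amalg_top : (Amalg.inl i j).range ⊔ (Amalg.inr i j).range = ⊤ := by
  have h : (Coprod.inl : G →* Coprod G H).range ⊔ (Coprod.inr : H →* Coprod G H).range = ⊤ :=
    Coprod.range_inl_sup_range_inr
  have h2 := congrArg (Subgroup.map (QuotientGroup.mk' (Subgroup.normalClosure
    {x : Coprod G H | ∃ a : A, x = Coprod.inr (j a) * (Coprod.inl (i a))⁻¹}))) h
  rw [Subgroup.map_sup, MonoidHom.map_range, MonoidHom.map_range,
    Subgroup.map_top_of_surjective _ (QuotientGroup.mk'_surjective _)] at h2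
  exact h2

/-- Comparison with the indexed pushout. -/
def toP : Amalg i j →* PushoutI (fmap i j) :=
  alift i j (PushoutI.of (φ := fmap i j) true) (PushoutI.of (φ := fmap i j) false) (fun a =>
    (PushoutI.of_apply_eq_base (fmap i j) true a).trans
      (PushoutI.of_apply_eq_base (fmap i j) false a).symm)

theorem toP_inl (x : G) :
    toP i j (Amalg.inl i j x) = PushoutI.of (φ := fmap i j) true x :=
  alift_inl i j _ _ _ x

theorem toP_inr (x : H) :
    toP i j (Amalg.inr i j x) = PushoutI.of (φ := fmap i j) false x :=
  alift_inr i j _ _ _ x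

/-- The two canonical maps as a family. -/
def fhom : ∀ b, Fam G H b →* Amalg i j
  | true => Amalg.inl i j
  | false => Amalg.inr i j

/-- Inverse comparison. -/
def ofP : PushoutI (fmap i j) →* Amalg i j :=
  PushoutI.lift (fhom i j) ((Amalg.inl i j).comp i) (by
    rintro (_ | _)
    · ext a; exact (amalg_glue i j a).symm
    · rfl)

theorem toP_injective : Injective (toP i j) := by
  have h : (ofP i j).comp (toP i j) = MonoidHom.id _ := by
    apply amalg_ext
    · intro x
      rw [MonoidHom.comp_apply, toP_inl]
      exact PushoutI.lift_of (fhom i j) _ _ (i := true) x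
    · intro x
      rw [MonoidHom.comp_apply, toP_inr]
      exact PushoutI.lift_of (fhom i j) _ _ (i := false) x
  intro x y hxy
  have := congrArg (ofP i j) hxy
  rwa [← MonoidHom.comp_apply, ← MonoidHom.comp_apply, h] at this

end

theorem main {A G H A' G' H' : Type} [Group A] [Group G] [Group H] [Group A'] [Group G'] [Group H']
    (i : A →* G) (j : A →* H) (i' : A' →* G') (j' : A' →* H')
    (f : G' →* G) (g : H' →* H) (k : A' →* A)
    (hi : Injective i) (hj : Injective j) (hi' : Injective i') (hj' : Injective j')
    (hf : Injective f) (hg : Injective g) (hk : Injective k)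
    (h1 : f.comp i' = i.comp k) (h2 : g.comp j' = j.comp k)
    (r1 : ∀ x, f x ∈ i.range → x ∈ i'.range) (r2 : ∀ x, g x ∈ j.range → x ∈ j'.range) :
    ∃ ψ : Amalg i' j' →* Amalg i j,
      ψ.comp (Amalg.inl _ _) = (Amalg.inl _ _).comp f ∧
      ψ.comp (Amalg.inr _ _) = (Amalg.inr _ _).comp g ∧
      Injective ψ ∧
      ψ.range = f.range.map (Amalg.inl i j) ⊔ g.range.map (Amalg.inr i j) := by
  have hc : ∀ a, ((Amalg.inl i j).comp f) (i' a) = ((Amalg.inr i j).comp g) (j' a) := by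
    intro a
    have e1 : f (i' a) = i (k a) := DFunLike.congr_fun h1 a
    have e2 : g (j' a) = j (k a) := DFunLike.congr_fun h2 a
    simp only [MonoidHom.comp_apply, e1, e2, amalg_glue]
  let ψ := alift i' j' ((Amalg.inl i j).comp f) ((Amalg.inr i j).comp g) hc
  have p1 : ψ.comp (Amalg.inl _ _) = (Amalg.inl _ _).comp f := by
    ext x; exact alift_inl _ _ _ _ hc x
  have p2 : ψ.comp (Amalg.inr _ _) = (Amalg.inr _ _).comp g := by
    ext x; exact alift_inr _ _ _ _ hc x
  refine ⟨ψ, p1, p2, ?_, ?_⟩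
  · have hkk : ∀ b, (fmor f g b).comp (fmap i' j' b) = (fmap i j b).comp k := by
      rintro (_ | _)
      · exact h2
      · exact h1
    have hinj : Injective (pmap (fmor f g) k hkk) := by
      apply pmap_injective
      · rintro (_ | _) <;> assumption
      · rintro (_ | _) <;> assumption
      · rintro (_ | _) <;> assumption
      · exact hk
      · rintro (_ | _)
        · exact r2
        · exact r1
    have hsq : (toP i j).comp ψ = (pmap (fmor f g) k hkk).comp (toP i' j') := by
      apply amalg_ext
      · intro x
        have e := DFunLike.congr_fun p1 x
        rw [MonoidHom.comp_apply, MonoidHom.comp_apply] at e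
        rw [MonoidHom.comp_apply, MonoidHom.comp_apply, e, toP_inl, toP_inl]
        exact (pmap_of (fmor f g) k hkk true x).symm
      · intro x
        have e := DFunLike.congr_fun p2 x
        rw [MonoidHom.comp_apply, MonoidHom.comp_apply] at e
        rw [MonoidHom.comp_apply, MonoidHom.comp_apply, e, toP_inr, toP_inr]
        exact (pmap_of (fmor f g) k hkk false x).symm
    have hcomp : Injective ((toP i j).comp ψ) := by
      rw [hsq]
      exact hinj.comp (toP_injective i' j')
    exact Injective.of_comp (f := toP i j) hcomp
  · rw [MonoidHom.range_eq_map, ← amalg_top, Subgroup.map_sup, MonoidHom.map_range,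
      MonoidHom.map_range, p1, p2, MonoidHom.map_range, MonoidHom.map_range]

end AmalgAux

theorem stmt0 (G H : Type) [Group G] [Group H]
    (A : Subgroup G) (B : Subgroup H) (φ : A ≃* B)
    (G' : Subgroup G) (H' : Subgroup H)
    -- `φ'` is the restriction of `φ` to `A' = G' ⊓ A`, an isomorphism onto `B' = H' ⊓ B`:
    (φ' : ↥(G' ⊓ A) ≃* ↥(H' ⊓ B))
    (hres : ∀ a : ↥(G' ⊓ A),
      ((φ' a : H)) = ((φ ⟨(a : G), (Subgroup.mem_inf.mp a.2).2⟩ : H))) :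
    -- the canonical homomorphism `G' *_{φ'} H' →* G *_φ H` is injective with image
    -- the subgroup generated by (the canonical images of) `G'` and `H'`
    ∃ ψ : Amalg (Subgroup.inclusion (inf_le_left : G' ⊓ A ≤ G'))
            ((Subgroup.inclusion (inf_le_left : H' ⊓ B ≤ H')).comp φ'.toMonoidHom) →*
          Amalg A.subtype (B.subtype.comp φ.toMonoidHom),
      ψ.comp (Amalg.inl _ _) = (Amalg.inl _ _).comp G'.subtype ∧
      ψ.comp (Amalg.inr _ _) = (Amalg.inr _ _).comp H'.subtype ∧
      Function.Injective ψ ∧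
      ψ.range = G'.map (Amalg.inl A.subtype (B.subtype.comp φ.toMonoidHom)) ⊔
                H'.map (Amalg.inr A.subtype (B.subtype.comp φ.toMonoidHom)) := by
  have key := AmalgAux.main A.subtype (B.subtype.comp φ.toMonoidHom)
    (Subgroup.inclusion (inf_le_left : G' ⊓ A ≤ G'))
    ((Subgroup.inclusion (inf_le_left : H' ⊓ B ≤ H')).comp φ'.toMonoidHom)
    G'.subtype H'.subtype (Subgroup.inclusion (inf_le_right : G' ⊓ A ≤ A))
    A.subtype_injective (B.subtype_injective.comp φ.injective)
    (Subgroup.inclusion_injective _)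
    ((Subgroup.inclusion_injective (inf_le_left : H' ⊓ B ≤ H')).comp φ'.injective)
    G'.subtype_injective H'.subtype_injective (Subgroup.inclusion_injective _)
    rfl
    (by ext a; exact hres a)
    (by
      rintro x ⟨a, ha⟩
      have hx : (x : G) ∈ A := by
        have : (a : G) = x := ha
        rw [← this]; exact a.2
      exact ⟨⟨x, x.2, hx⟩, rfl⟩)
    (by
      rintro x ⟨a, ha⟩
      have hx : (x : H) ∈ B := by
        have : ((φ a : B) : H) = x := ha
        rw [← this]; exact (φ a).2
      refine ⟨φ'.symm ⟨x, x.2, hx⟩, ?_⟩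
      apply Subtype.ext
      change ((φ' (φ'.symm ⟨x, x.2, hx⟩) : ↥(H' ⊓ B)) : H) = x
      rw [MulEquiv.apply_symm_apply])
  simpa only [Subgroup.range_subtype] using key
end

section
/- Let Γ = G *_φ H be the free product of groups G and H with subgroups A ≤ G and B ≤ H amalgamated via an isomorphism φ : A → B. Let G' ≤ G and H' ≤ H be subgroups such that, with A' = G' ∩ A and B' = H' ∩ B, one has φ(A') = B'. Then for the subgroup Γ' = ⟨G', H'⟩ of Γ generated by the canonical images of G' and H', one has Γ' ∩ A = A' and Γ' ∩ B = B' (as subgroups of Γ, identifying A, B, A', B' with their canonical images). -/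
open Monoid

open Monoid.PushoutI Monoid.CoprodI in
/-- Elements that are a base element of `T` times a reduced word with letters in the `S i`. -/
def GoodElt {ι : Type} {K : ι → Type} {L : Type} [∀ i, Group (K i)] [Group L]
    (φ : ∀ i, L →* K i) (S : ∀ i, Subgroup (K i)) (T : Subgroup L) (x : PushoutI φ) : Prop :=
  ∃ h ∈ T, ∃ w : Word K, Reduced φ w ∧ (∀ g ∈ w.toList, g.2 ∈ S g.1) ∧
    x = base φ h * ofCoprodI w.prod

open Monoid.PushoutI Monoid.CoprodI in
theorem goodElt_cons {ι : Type} {K : ι → Type} {L : Type} [∀ i, Group (K i)] [Group L]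
    (φ : ∀ i, L →* K i) (S : ∀ i, Subgroup (K i)) (T : Subgroup L)
    (hT : ∀ i h, φ i h ∈ S i ↔ h ∈ T) (i : ι) (g : K i) (hg : g ∈ S i)
    (w : Word K) (hw : Reduced φ w) (hS : ∀ g ∈ w.toList, g.2 ∈ S g.1)
    (hi : w.fstIdx ≠ some i) :
    GoodElt φ S T (of i g * ofCoprodI w.prod) := by
  by_cases hr : g ∈ (φ i).range
  · obtain ⟨h, rfl⟩ := hr
    exact ⟨h, (hT i h).1 hg, w, hw, hS, by rw [of_apply_eq_base]⟩
  · have h1 : g ≠ 1 := fun h => hr (h ▸ one_mem _)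
    refine ⟨1, one_mem _, Word.cons g w hi h1, ?_, ?_, ?_⟩
    · intro l hl
      rcases List.mem_cons.1 hl with rfl | hl
      · exact hr
      · exact hw l hl
    · intro l hl
      rcases List.mem_cons.1 hl with rfl | hl
      · exact hg
      · exact hS l hl
    · simp

open Monoid.PushoutI Monoid.CoprodI in
theorem goodElt_mul {ι : Type} {K : ι → Type} {L : Type} [∀ i, Group (K i)] [Group L]
    (φ : ∀ i, L →* K i) (S : ∀ i, Subgroup (K i)) (T : Subgroup L)
    (hT : ∀ i h, φ i h ∈ S i ↔ h ∈ T) (i : ι) (g : K i) (hg : g ∈ S i)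
    (x : PushoutI φ) (hx : GoodElt φ S T x) : GoodElt φ S T (of i g * x) := by
  obtain ⟨h, hh, w, hw, hS, rfl⟩ := hx
  rw [← of_apply_eq_base φ i, ← mul_assoc, ← map_mul]
  have hg' : g * φ i h ∈ S i := mul_mem hg ((hT i h).2 hh)
  generalize g * φ i h = k at hg'
  by_cases hi : w.fstIdx = some i
  · induction w using Word.consRecOn with
    | empty => simp [Word.fstIdx] at hi
    | cons j m w hj h1 _ =>
      obtain rfl : j = i := by simpa [Word.fstIdx] using hi
      have hm : m ∈ S j := hS ⟨j, m⟩ (by simp)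
      have := goodElt_cons φ S T hT j (k * m) (mul_mem hg' hm) w
        (fun l hl => hw l (List.mem_cons_of_mem _ hl))
        (fun l hl => hS l (List.mem_cons_of_mem _ hl)) hj
      simpa [mul_assoc] using this
  · exact goodElt_cons φ S T hT i k hg' w hw hS hi

open Monoid.PushoutI Monoid.CoprodI in
theorem pushout_key {ι : Type} {K : ι → Type} {L : Type} [∀ i, Group (K i)] [Group L]
    (φ : ∀ i, L →* K i) (hφ : ∀ i, Function.Injective (φ i))
    (S : ∀ i, Subgroup (K i)) (T : Subgroup L)
    (hT : ∀ i h, φ i h ∈ S i ↔ h ∈ T) (h : L)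
    (hx : base φ h ∈ ⨆ i, (S i).map (of (φ := φ) i)) : h ∈ T := by
  have key : ∀ x ∈ ⨆ i, (S i).map (of (φ := φ) i),
      ∀ y, GoodElt φ S T y → GoodElt φ S T (x * y) := by
    intro x hx
    induction hx using Subgroup.iSup_induction' with
    | hp i x hx =>
      obtain ⟨g, hg, rfl⟩ := hx
      exact goodElt_mul φ S T hT i g hg
    | h1 => simp
    | hmul x y _ _ hx hy =>
      intro z hz
      rw [mul_assoc]
      exact hx _ (hy _ hz)
  have h1 : GoodElt φ S T 1 :=
    ⟨1, one_mem _, Word.empty, by intro l hl; simp [Word.empty] at hl,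
      by intro l hl; simp [Word.empty] at hl, by simp⟩
  obtain ⟨t, ht, w, hw, -, he⟩ := key _ hx _ h1
  rw [mul_one] at he
  have hwe : w = .empty := by
    refine hw.eq_empty_of_mem_range hφ ⟨t⁻¹ * h, ?_⟩
    rw [map_mul, he]; simp
  subst hwe
  have : h = t := base_injective hφ (by simpa using he)
  exact this ▸ ht

/-- The two-element family of groups. -/
abbrev Fam (G H : Type) (b : Bool) : Type := cond b G H

instance famGroup (G H : Type) [Group G] [Group H] : ∀ b, Group (Fam G H b)
  | true => inferInstanceAs (Group G)
  | false => inferInstanceAs (Group H)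

/-- The family of maps. -/
def famHom {A G H : Type} [Group A] [Group G] [Group H] (i : A →* G) (j : A →* H) :
    ∀ b, A →* Fam G H b
  | true => i
  | false => j

/-- The family of subgroups. -/
def famSub {G H : Type} [Group G] [Group H] (G' : Subgroup G) (H' : Subgroup H) :
    ∀ b, Subgroup (Fam G H b)
  | true => G'
  | false => (H' : Subgroup H)

/-- Left inclusion into the indexed pushout. -/
def pInl {A G H : Type} [Group A] [Group G] [Group H] (i : A →* G) (j : A →* H) :
    G →* PushoutI (famHom i j) := PushoutI.of (φ := famHom i j) true

/-- Right inclusion into the indexed pushout. -/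
def pInr {A G H : Type} [Group A] [Group G] [Group H] (i : A →* G) (j : A →* H) :
    H →* PushoutI (famHom i j) := PushoutI.of (φ := famHom i j) false

theorem pInl_base {A G H : Type} [Group A] [Group G] [Group H] (i : A →* G) (j : A →* H) (a : A) :
    pInl i j (i a) = PushoutI.base (famHom i j) a :=
  PushoutI.of_apply_eq_base (famHom i j) true a

theorem pInr_base {A G H : Type} [Group A] [Group G] [Group H] (i : A →* G) (j : A →* H) (a : A) :
    pInr i j (j a) = PushoutI.base (famHom i j) a :=
  PushoutI.of_apply_eq_base (famHom i j) false a

/-- The comparison map to the indexed pushout. -/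
def toP {A G H : Type} [Group A] [Group G] [Group H] (i : A →* G) (j : A →* H) :
    Amalg i j →* PushoutI (famHom i j) :=
  QuotientGroup.lift _ (Coprod.lift (pInl i j) (pInr i j)) (by
    intro x hx
    have : Subgroup.normalClosure
        {x : Coprod G H | ∃ a : A, x = Coprod.inr (j a) * (Coprod.inl (i a))⁻¹} ≤
        (Coprod.lift (pInl i j) (pInr i j)).ker := by
      apply Subgroup.normalClosure_le_normal
      rintro _ ⟨a, rfl⟩
      simp [MonoidHom.mem_ker, pInl_base, pInr_base]
    exact this hx)

theorem toP_inl {A G H : Type} [Group A] [Group G] [Group H] (i : A →* G) (j : A →* H) (g : G) :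
    toP i j (Amalg.inl i j g) = pInl i j g := by
  simp [toP, Amalg.inl]

theorem toP_inr {A G H : Type} [Group A] [Group G] [Group H] (i : A →* G) (j : A →* H) (g : H) :
    toP i j (Amalg.inr i j g) = pInr i j g := by
  simp [toP, Amalg.inr]

theorem amalg_inl_eq_inr {A G H : Type} [Group A] [Group G] [Group H] (i : A →* G) (j : A →* H)
    (a : A) : Amalg.inl i j (i a) = Amalg.inr i j (j a) := by
  have : (QuotientGroup.mk' (Subgroup.normalClosure
    {x : Coprod G H | ∃ a : A, x = Coprod.inr (j a) * (Coprod.inl (i a))⁻¹}))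
      (Coprod.inr (j a) * (Coprod.inl (i a))⁻¹) = 1 :=
    (QuotientGroup.eq_one_iff _).2 (Subgroup.subset_normalClosure ⟨a, rfl⟩)
  rw [map_mul, map_inv, mul_inv_eq_one] at this
  exact this.symm

theorem amalg_key {A G H : Type} [Group A] [Group G] [Group H] (i : A →* G) (j : A →* H)
    (hi : Function.Injective i) (hj : Function.Injective j)
    (G' : Subgroup G) (H' : Subgroup H) (hφ : ∀ a, i a ∈ G' ↔ j a ∈ H') (a : A)
    (ha : Amalg.inl i j (i a) ∈ G'.map (Amalg.inl i j) ⊔ H'.map (Amalg.inr i j)) :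
    i a ∈ G' := by
  refine pushout_key (famHom i j) (by rintro (_ | _); exacts [hj, hi]) (famSub G' H')
    (G'.comap i) (by rintro (_ | _) h; exacts [(hφ h).symm, Iff.rfl]) a ?_
  rw [← pInl_base, ← toP_inl]
  have hle : G'.map (Amalg.inl i j) ⊔ H'.map (Amalg.inr i j) ≤
      (⨆ b, (famSub G' H' b).map (PushoutI.of (φ := famHom i j) b)).comap (toP i j) := by
    refine sup_le ?_ ?_
    · rintro _ ⟨g, hg, rfl⟩
      rw [Subgroup.mem_comap, toP_inl]
      exact Subgroup.mem_iSup_of_mem true ⟨g, hg, rfl⟩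
    · rintro _ ⟨g, hg, rfl⟩
      rw [Subgroup.mem_comap, toP_inr]
      exact Subgroup.mem_iSup_of_mem false ⟨g, hg, rfl⟩
  exact hle ha

theorem stmt1 (G H : Type) [Group G] [Group H]
    (A : Subgroup G) (B : Subgroup H) (φ : A ≃* B)
    (G' : Subgroup G) (H' : Subgroup H)
    (hφ : ∀ a : A, (a : G) ∈ G' ↔ ((φ a : H)) ∈ H') :
    (G'.map (Amalg.inl A.subtype (B.subtype.comp φ.toMonoidHom)) ⊔
       H'.map (Amalg.inr A.subtype (B.subtype.comp φ.toMonoidHom))) ⊓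
      A.map (Amalg.inl A.subtype (B.subtype.comp φ.toMonoidHom)) =
      (G' ⊓ A).map (Amalg.inl A.subtype (B.subtype.comp φ.toMonoidHom)) ∧
    (G'.map (Amalg.inl A.subtype (B.subtype.comp φ.toMonoidHom)) ⊔
       H'.map (Amalg.inr A.subtype (B.subtype.comp φ.toMonoidHom))) ⊓
      B.map (Amalg.inr A.subtype (B.subtype.comp φ.toMonoidHom)) =
      (H' ⊓ B).map (Amalg.inr A.subtype (B.subtype.comp φ.toMonoidHom)) := by
  have key := amalg_key A.subtype (B.subtype.comp φ.toMonoidHom) A.subtype_injective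
    (B.subtype_injective.comp φ.injective) G' H' hφ
  have heq := amalg_inl_eq_inr A.subtype (B.subtype.comp φ.toMonoidHom)
  constructor
  · apply le_antisymm
    · rintro _ ⟨hx, a, ha, rfl⟩
      exact ⟨a, ⟨key ⟨a, ha⟩ hx, ha⟩, rfl⟩
    · rintro _ ⟨a, ⟨ha', ha⟩, rfl⟩
      exact ⟨(le_sup_left : _ ≤ _ ⊔ H'.map _) ⟨a, ha', rfl⟩, a, ha, rfl⟩
  · apply le_antisymm
    · rintro _ ⟨hx, b, hb, rfl⟩
      obtain ⟨a, ha⟩ := φ.surjective ⟨b, hb⟩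
      obtain rfl : (φ a : H) = b := congrArg Subtype.val ha
      have h2 := heq a
      refine ⟨_, ⟨(hφ a).1 (key a ?_), hb⟩, rfl⟩
      rw [h2]
      exact hx
    · rintro _ ⟨b, ⟨hb', hb⟩, rfl⟩
      exact ⟨(le_sup_right : _ ≤ G'.map _ ⊔ _) ⟨b, hb', rfl⟩, b, hb, rfl⟩
end

section
/- Let Γ = G *_φ t be the HNN extension of a group G by a stable letter t with respect to an isomorphism φ : A → B between subgroups A, B ≤ G. Let G' ≤ G be a subgroup such that, with A' = G' ∩ A and B' = G' ∩ B, one has φ(A') = B', and let φ' : A' → B' be the restriction of φ. Then the subgroup Γ' = ⟨G', t⟩ of Γ generated by the canonical image of G' together with the stable letter t is naturally isomorphic to the HNN extension G' *_{φ'} t; that is, the canonical homomorphism G' *_{φ'} t → Γ sending stable letter to stable letter is injective with image Γ'. -/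
theorem stmt5 (G : Type) [Group G]
    (A B : Subgroup G) (φ : A ≃* B) (G' : Subgroup G)
    -- `φ'` is the restriction of `φ` to `A' = G' ⊓ A`, an isomorphism onto `B' = G' ⊓ B`:
    (φ' : ↥(G' ⊓ A) ≃* ↥(G' ⊓ B))
    (hres : ∀ a : ↥(G' ⊓ A),
      ((φ' a : G)) = ((φ ⟨(a : G), (Subgroup.mem_inf.mp a.2).2⟩ : G))) :
    -- the canonical homomorphism `G' *_{φ'} t →* G *_φ t`, sending the stable letter to
    -- the stable letter, is injective with image `⟨G', t⟩`
    ∃ ψ : HNNExtension ↥G' ((G' ⊓ A).subgroupOf G') ((G' ⊓ B).subgroupOf G')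
            (((Subgroup.subgroupOfEquivOfLe (inf_le_left : G' ⊓ A ≤ G')).trans φ').trans
              (Subgroup.subgroupOfEquivOfLe (inf_le_left : G' ⊓ B ≤ G')).symm) →*
          HNNExtension G A B φ,
      ψ.comp HNNExtension.of = HNNExtension.of.comp G'.subtype ∧
      ψ HNNExtension.t = HNNExtension.t ∧
      Function.Injective ψ ∧
      ψ.range = G'.map (HNNExtension.of : G →* HNNExtension G A B φ) ⊔
        Subgroup.zpowers (HNNExtension.t : HNNExtension G A B φ) := by
  have hx : ∀ a : ((G' ⊓ A).subgroupOf G'), (HNNExtension.t : HNNExtension G A B φ) *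
      (HNNExtension.of.comp G'.subtype) (a : G') = (HNNExtension.of.comp G'.subtype)
        (((((Subgroup.subgroupOfEquivOfLe (inf_le_left : G' ⊓ A ≤ G')).trans φ').trans
              (Subgroup.subgroupOfEquivOfLe (inf_le_left : G' ⊓ B ≤ G')).symm) a : 
              ((G' ⊓ B).subgroupOf G')) : G') * HNNExtension.t := by
    intro a
    have ha : ((a : G') : G) ∈ A := (Subgroup.mem_inf.mp (Subgroup.mem_subgroupOf.mp a.2)).2
    have h1 := HNNExtension.t_mul_of (φ := φ) ⟨((a : G') : G), ha⟩
    have h2 := hres (Subgroup.subgroupOfEquivOfLe (inf_le_left : G' ⊓ A ≤ G') a)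
    refine h1.trans ?_
    exact congrArg (fun g : G => (HNNExtension.of g : HNNExtension G A B φ) * HNNExtension.t) h2.symm
  refine ⟨HNNExtension.lift (HNNExtension.of.comp G'.subtype) HNNExtension.t hx, ?_, ?_, ?_, ?_⟩
  · ext g
    simp
  · simp
  · rw [injective_iff_map_eq_one]
    intro x hx1
    obtain ⟨d⟩ := HNNExtension.NormalWord.TransversalPair.nonempty G'
      ((G' ⊓ A).subgroupOf G') ((G' ⊓ B).subgroupOf G')
    obtain ⟨w, rfl⟩ := (HNNExtension.NormalWord.equiv
      (((Subgroup.subgroupOfEquivOfLe (inf_le_left : G' ⊓ A ≤ G')).trans φ').trans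
              (Subgroup.subgroupOfEquivOfLe (inf_le_left : G' ⊓ B ≤ G')).symm) d).symm.surjective x
    have hmem : ∀ (u : ℤˣ) (g : G'), (g : G) ∈ HNNExtension.toSubgroup A B u →
        g ∈ HNNExtension.toSubgroup ((G' ⊓ A).subgroupOf G') ((G' ⊓ B).subgroupOf G') u := by
      intro u g hg
      rcases Int.units_eq_one_or u with rfl | rfl
      · exact Subgroup.mem_subgroupOf.mpr ⟨g.2, hg⟩
      · exact Subgroup.mem_subgroupOf.mpr ⟨g.2, hg⟩
    let v : HNNExtension.NormalWord.ReducedWord G A B :=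
      { head := (w.head : G)
        toList := w.toList.map (fun p => (p.1, (p.2 : G)))
        chain := by
          rw [List.isChain_map]
          exact w.chain.imp (fun a b h hab => h (hmem _ _ hab)) }
    have hv : v.prod φ = HNNExtension.lift (HNNExtension.of.comp G'.subtype) HNNExtension.t hx
        (w.toReducedWord.prod _) := by
      simp [HNNExtension.NormalWord.ReducedWord.prod, v, map_list_prod, Function.comp_def]
    have hv1 : v.prod φ = 1 := hv.trans hx1
    have hnil : v.toList = [] := HNNExtension.ReducedWord.toList_eq_nil_of_mem_of_range φ v
      (by rw [hv1]; exact one_mem _)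
    have hwnil : w.toList = [] := by simpa [v] using hnil
    have hhead : w.head = 1 := by
      have : (HNNExtension.of (w.head : G) : HNNExtension G A B φ) = HNNExtension.of 1 := by
        simpa [HNNExtension.NormalWord.ReducedWord.prod, v, hwnil] using hv1
      exact Subtype.ext (HNNExtension.of_injective φ this)
    change w.toReducedWord.prod _ = 1
    simp [HNNExtension.NormalWord.ReducedWord.prod, hwnil, hhead]
  · apply le_antisymm
    · rintro _ ⟨x, rfl⟩
      induction x using HNNExtension.induction_on with
      | of g =>
        rw [HNNExtension.lift_of]
        exact Subgroup.mem_sup_left ⟨g, g.2, rfl⟩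
      | t =>
        rw [HNNExtension.lift_t]
        exact Subgroup.mem_sup_right (Subgroup.mem_zpowers _)
      | mul x y hx hy => rw [map_mul]; exact mul_mem hx hy
      | inv x hx => rw [map_inv]; exact inv_mem hx
    · refine sup_le ?_ ?_
      · rintro _ ⟨g, hg, rfl⟩
        exact ⟨HNNExtension.of ⟨g, hg⟩, by rw [HNNExtension.lift_of]; rfl⟩
      · rw [Subgroup.zpowers_le]
        exact ⟨HNNExtension.t, by rw [HNNExtension.lift_t]⟩
end

section
/- Let Γ = G *_φ t be the HNN extension of a group G by a stable letter t with respect to an isomorphism φ : A → B between subgroups A, B ≤ G. Let G' ≤ G be a subgroup such that, with A' = G' ∩ A and B' = G' ∩ B, one has φ(A') = B'. Then for the subgroup Γ' = ⟨G', t⟩ of Γ one has Γ' ∩ G = G', Γ' ∩ A = A', and Γ' ∩ B = B' (as subgroups of Γ, identifying subgroups of G with their canonical images). -/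
/-- Elements represented by a reduced word all of whose letters lie in `G'`. -/
def HNNGood {G : Type} [Group G] {A B : Subgroup G} (φ : A ≃* B) (G' : Subgroup G)
    (x : HNNExtension G A B φ) : Prop :=
  ∃ w : HNNExtension.NormalWord.ReducedWord G A B,
    w.prod φ = x ∧ w.head ∈ G' ∧ ∀ p ∈ w.toList, p.2 ∈ G'

theorem hnnGood_of_mul {G : Type} [Group G] {A B : Subgroup G} (φ : A ≃* B) (G' : Subgroup G)
    (g : G) (hg : g ∈ G') (x : HNNExtension G A B φ) (hx : HNNGood φ G' x) :
    HNNGood φ G' (HNNExtension.of g * x) := by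
  obtain ⟨w, rfl, h1, h2⟩ := hx
  exact ⟨⟨g * w.head, w.toList, w.chain⟩,
    by simp [HNNExtension.NormalWord.ReducedWord.prod, mul_assoc], mul_mem hg h1, h2⟩

theorem hnn_conj {G : Type} [Group G] {A B : Subgroup G} (φ : A ≃* B) (G' : Subgroup G)
    (hφ : ∀ a : A, (a : G) ∈ G' ↔ ((φ a : G)) ∈ G') (u : ℤˣ) (h : G)
    (hu : h ∈ HNNExtension.toSubgroup A B u) (hh : h ∈ G') :
    ∃ k ∈ G', (HNNExtension.t ^ (u : ℤ) * HNNExtension.of h : HNNExtension G A B φ) =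
      HNNExtension.of k * HNNExtension.t ^ (u : ℤ) := by
  rcases Int.units_eq_one_or u with rfl | rfl
  · refine ⟨φ ⟨h, hu⟩, (hφ ⟨h, hu⟩).1 hh, ?_⟩
    simpa using HNNExtension.t_mul_of (φ := φ) ⟨h, hu⟩
  · refine ⟨φ.symm ⟨h, hu⟩, (hφ _).2 (by simpa using hh), ?_⟩
    simpa using HNNExtension.inv_t_mul_of (φ := φ) ⟨h, hu⟩

theorem hnnGood_t_mul {G : Type} [Group G] {A B : Subgroup G} (φ : A ≃* B) (G' : Subgroup G)
    (hφ : ∀ a : A, (a : G) ∈ G' ↔ ((φ a : G)) ∈ G') (u : ℤˣ)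
    (x : HNNExtension G A B φ) (hx : HNNGood φ G' x) :
    HNNGood φ G' (HNNExtension.t ^ (u : ℤ) * x) := by
  obtain ⟨⟨h, l, hc⟩, rfl, h1, h2⟩ := hx
  dsimp only at h1 h2
  by_cases hcan : ∀ p ∈ l.head?, h ∈ HNNExtension.toSubgroup A B u → u = p.1
  · refine ⟨⟨1, (u, h) :: l, List.isChain_cons.2 ⟨hcan, hc⟩⟩, ?_, one_mem _, ?_⟩
    · simp [HNNExtension.NormalWord.ReducedWord.prod, mul_assoc]
    · intro p hp
      rcases List.mem_cons.1 hp with rfl | hp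
      · exact h1
      · exact h2 p hp
  · push Not at hcan
    obtain ⟨⟨v, g⟩, hp, hm, hne⟩ := hcan
    obtain ⟨l', rfl⟩ : ∃ l', l = (v, g) :: l' := by
      cases l with
      | nil => simp at hp
      | cons a l' => simp at hp; exact ⟨l', by rw [hp]⟩
    have hv : v = -u := by
      have := Int.units_ne_iff_eq_neg.1 hne
      rw [this, neg_neg]
    subst hv
    obtain ⟨k, hk, hkt⟩ := hnn_conj φ G' hφ u h hm h1
    refine ⟨⟨k * g, l', (List.isChain_cons.1 hc).2⟩, ?_, mul_mem hk (h2 (-u, g) (by simp)), ?_⟩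
    · simp only [HNNExtension.NormalWord.ReducedWord.prod, List.map_cons, List.prod_cons, map_mul,
        ← mul_assoc]
      rw [hkt]
      simp [mul_assoc]
    · exact fun p hp => h2 p (List.mem_cons_of_mem _ hp)

theorem hnnGood_of_mem {G : Type} [Group G] {A B : Subgroup G} (φ : A ≃* B) (G' : Subgroup G)
    (hφ : ∀ a : A, (a : G) ∈ G' ↔ ((φ a : G)) ∈ G')
    (x : HNNExtension G A B φ)
    (hx : x ∈ G'.map (HNNExtension.of : G →* HNNExtension G A B φ) ⊔
        Subgroup.zpowers (HNNExtension.t : HNNExtension G A B φ)) : HNNGood φ G' x := by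
  rw [Subgroup.zpowers_eq_closure, ← Subgroup.closure_eq (G'.map _), ← Subgroup.closure_union] at hx
  induction hx using Subgroup.closure_induction_left with
  | one => exact ⟨⟨1, [], by simp⟩, by simp [HNNExtension.NormalWord.ReducedWord.prod], by simp, by simp⟩
  | mul_left y hy z hz ih =>
    rcases hy with ⟨g, hg, rfl⟩ | rfl
    · exact hnnGood_of_mul φ G' g hg _ ih
    · simpa using hnnGood_t_mul φ G' hφ 1 _ ih
  | inv_mul_cancel y hy z hz ih =>
    rcases hy with ⟨g, hg, rfl⟩ | rfl
    · rw [← map_inv]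
      exact hnnGood_of_mul φ G' g⁻¹ (inv_mem hg) _ ih
    · simpa using hnnGood_t_mul φ G' hφ (-1) _ ih

theorem hnn_mem_of {G : Type} [Group G] {A B : Subgroup G} (φ : A ≃* B) (G' : Subgroup G)
    (hφ : ∀ a : A, (a : G) ∈ G' ↔ ((φ a : G)) ∈ G') (g : G)
    (hx : (HNNExtension.of g : HNNExtension G A B φ) ∈
      G'.map (HNNExtension.of : G →* HNNExtension G A B φ) ⊔
        Subgroup.zpowers (HNNExtension.t : HNNExtension G A B φ)) : g ∈ G' := by
  obtain ⟨w, hw, h1, h2⟩ := hnnGood_of_mem φ G' hφ _ hx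
  have hn := HNNExtension.ReducedWord.toList_eq_nil_of_mem_of_range φ w (hw ▸ ⟨g, rfl⟩)
  have : (HNNExtension.of w.head : HNNExtension G A B φ) = HNNExtension.of g := by
    rw [← hw]; simp [HNNExtension.NormalWord.ReducedWord.prod, hn]
  exact HNNExtension.of_injective φ this ▸ h1


theorem stmt6 (G : Type) [Group G]
    (A B : Subgroup G) (φ : A ≃* B) (G' : Subgroup G)
    -- `φ` carries `A' = G' ⊓ A` exactly onto `B' = G' ⊓ B`:
    (hφ : ∀ a : A, (a : G) ∈ G' ↔ ((φ a : G)) ∈ G') :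
    -- `Γ' ∩ G = G'`, `Γ' ∩ A = A'` and `Γ' ∩ B = B'` for `Γ' = ⟨G', t⟩` in `Γ = G *_φ t`
    (G'.map (HNNExtension.of : G →* HNNExtension G A B φ) ⊔
        Subgroup.zpowers (HNNExtension.t : HNNExtension G A B φ)) ⊓
      (HNNExtension.of : G →* HNNExtension G A B φ).range =
      G'.map (HNNExtension.of : G →* HNNExtension G A B φ) ∧
    (G'.map (HNNExtension.of : G →* HNNExtension G A B φ) ⊔
        Subgroup.zpowers (HNNExtension.t : HNNExtension G A B φ)) ⊓
      A.map (HNNExtension.of : G →* HNNExtension G A B φ) =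
      (G' ⊓ A).map (HNNExtension.of : G →* HNNExtension G A B φ) ∧
    (G'.map (HNNExtension.of : G →* HNNExtension G A B φ) ⊔
        Subgroup.zpowers (HNNExtension.t : HNNExtension G A B φ)) ⊓
      B.map (HNNExtension.of : G →* HNNExtension G A B φ) =
      (G' ⊓ B).map (HNNExtension.of : G →* HNNExtension G A B φ) := by
  refine ⟨le_antisymm ?_ ?_, le_antisymm ?_ ?_, le_antisymm ?_ ?_⟩
  · rintro _ ⟨hx, g, rfl⟩
    exact ⟨g, hnn_mem_of φ G' hφ g hx, rfl⟩
  · rintro _ ⟨g, hg, rfl⟩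
    exact ⟨Subgroup.mem_sup_left ⟨g, hg, rfl⟩, g, rfl⟩
  · rintro _ ⟨hx, g, hg, rfl⟩
    exact ⟨g, ⟨hnn_mem_of φ G' hφ g hx, hg⟩, rfl⟩
  · rintro _ ⟨g, hg, rfl⟩
    exact ⟨Subgroup.mem_sup_left ⟨g, hg.1, rfl⟩, g, hg.2, rfl⟩
  · rintro _ ⟨hx, g, hg, rfl⟩
    exact ⟨g, ⟨hnn_mem_of φ G' hφ g hx, hg⟩, rfl⟩
  · rintro _ ⟨g, hg, rfl⟩
    exact ⟨Subgroup.mem_sup_left ⟨g, hg.1, rfl⟩, g, hg.2, rfl⟩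
end

section
/- Let Γ = G *_A t be the HNN extension of a group G by a stable letter t fixing a subgroup A ≤ G pointwise (i.e., the case φ = id_A), and let G' ≤ G be any subgroup. Set Γ' = ⟨G', t⟩ ≤ Γ and A' = G' ∩ A. Then: (1) Γ' is naturally isomorphic to the HNN extension G' *_{A'} t (in particular, if A ≤ G', then Γ' ≅ G' *_A t); (2) Γ' ∩ A = A' (in particular, Γ' ∩ A = A when A ≤ G'); and (3) Γ' ∩ G = G'. -/
theorem stmt7_aux {G : Type} [Group G] (A G' : Subgroup G)
    (ψ : HNNExtension ↥G' ((G' ⊓ A).subgroupOf G') ((G' ⊓ A).subgroupOf G')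
            (MulEquiv.refl _) →* HNNExtension G A A (MulEquiv.refl A))
    (h1 : ∀ g : G', ψ (HNNExtension.of g) = HNNExtension.of (g : G))
    (h2 : ψ HNNExtension.t = HNNExtension.t)
    (x : HNNExtension ↥G' ((G' ⊓ A).subgroupOf G') ((G' ⊓ A).subgroupOf G') (MulEquiv.refl _))
    (hx : ψ x ∈ (HNNExtension.of : G →* HNNExtension G A A (MulEquiv.refl A)).range) :
    ∃ g : G', x = HNNExtension.of g := by
  obtain ⟨d⟩ := HNNExtension.NormalWord.TransversalPair.nonempty ↥G'
    ((G' ⊓ A).subgroupOf G') ((G' ⊓ A).subgroupOf G')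
  obtain ⟨w, rfl⟩ := (HNNExtension.NormalWord.equiv (MulEquiv.refl _) d).symm.surjective x
  change ψ (w.prod _) ∈ _ at hx
  change ∃ g : G', w.prod _ = _
  let w' : HNNExtension.NormalWord.ReducedWord G A A :=
    { head := w.head
      toList := w.toList.map (fun p => (p.1, (p.2 : G)))
      chain := by
        rw [List.isChain_map]
        refine w.chain.imp ?_
        intro a b hab ha
        apply hab
        simp only [HNNExtension.toSubgroup, ite_self] at ha ⊢
        exact Subgroup.mem_subgroupOf.2 ⟨a.2.2, ha⟩ }
  have hw : w'.prod (MulEquiv.refl A) = ψ (w.prod (MulEquiv.refl _)) := by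
    simp only [HNNExtension.NormalWord.ReducedWord.prod, map_mul, h1, map_list_prod,
      List.map_map, w']
    congr 3
    funext p
    simp [h1, h2]
  have hnil := HNNExtension.ReducedWord.toList_eq_nil_of_mem_of_range (MulEquiv.refl A) w'
    (by rw [hw]; exact hx)
  have hnil' : w.toList = [] := by simpa [w'] using hnil
  exact ⟨w.head, by simp [HNNExtension.NormalWord.ReducedWord.prod, hnil']⟩

theorem stmt7 (G : Type) [Group G] (A : Subgroup G) (G' : Subgroup G) :
    -- (1) `⟨G', t⟩` is naturally isomorphic to `G' *_{A'} t` where `A' = G' ⊓ A`: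
    (∃ ψ : HNNExtension ↥G' ((G' ⊓ A).subgroupOf G') ((G' ⊓ A).subgroupOf G')
            (MulEquiv.refl _) →*
          HNNExtension G A A (MulEquiv.refl A),
      ψ.comp HNNExtension.of = HNNExtension.of.comp G'.subtype ∧
      ψ HNNExtension.t = HNNExtension.t ∧
      Function.Injective ψ ∧
      ψ.range = G'.map (HNNExtension.of : G →* HNNExtension G A A (MulEquiv.refl A)) ⊔
        Subgroup.zpowers (HNNExtension.t : HNNExtension G A A (MulEquiv.refl A))) ∧
    -- (2) `Γ' ∩ A = A'`:
    (G'.map (HNNExtension.of : G →* HNNExtension G A A (MulEquiv.refl A)) ⊔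
        Subgroup.zpowers (HNNExtension.t : HNNExtension G A A (MulEquiv.refl A))) ⊓
      A.map (HNNExtension.of : G →* HNNExtension G A A (MulEquiv.refl A)) =
      (G' ⊓ A).map (HNNExtension.of : G →* HNNExtension G A A (MulEquiv.refl A)) ∧
    -- (3) `Γ' ∩ G = G'`:
    (G'.map (HNNExtension.of : G →* HNNExtension G A A (MulEquiv.refl A)) ⊔
        Subgroup.zpowers (HNNExtension.t : HNNExtension G A A (MulEquiv.refl A))) ⊓
      (HNNExtension.of : G →* HNNExtension G A A (MulEquiv.refl A)).range =
      G'.map (HNNExtension.of : G →* HNNExtension G A A (MulEquiv.refl A)) := by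
  let ψ : HNNExtension ↥G' ((G' ⊓ A).subgroupOf G') ((G' ⊓ A).subgroupOf G')
      (MulEquiv.refl _) →* HNNExtension G A A (MulEquiv.refl A) :=
    HNNExtension.lift (HNNExtension.of.comp G'.subtype) HNNExtension.t (by
      intro a
      exact HNNExtension.t_mul_of (φ := MulEquiv.refl A)
        ⟨((a : G') : G), (Subgroup.mem_subgroupOf.1 a.2).2⟩)
  have h1 : ∀ g : G', ψ (HNNExtension.of g) = HNNExtension.of (g : G) := by
    intro g; exact HNNExtension.lift_of _ _ _ g
  have h2 : ψ HNNExtension.t = HNNExtension.t := HNNExtension.lift_t _ _ _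
  have key := stmt7_aux A G' ψ h1 h2
  have hr : ψ.range = G'.map (HNNExtension.of : G →* HNNExtension G A A (MulEquiv.refl A)) ⊔
        Subgroup.zpowers (HNNExtension.t : HNNExtension G A A (MulEquiv.refl A)) := by
    apply le_antisymm
    · rintro _ ⟨x, rfl⟩
      induction x using HNNExtension.induction_on with
      | of g =>
        rw [h1]
        exact Subgroup.mem_sup_left (Subgroup.mem_map_of_mem _ g.2)
      | t =>
        rw [h2]
        exact Subgroup.mem_sup_right (Subgroup.mem_zpowers _)
      | mul x y hx hy => rw [map_mul]; exact mul_mem hx hy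
      | inv x hx => rw [map_inv]; exact inv_mem hx
    · apply sup_le
      · rintro _ ⟨g, hg, rfl⟩
        exact ⟨HNNExtension.of ⟨g, hg⟩, h1 _⟩
      · rw [Subgroup.zpowers_le]
        exact ⟨_, h2⟩
  have h3 : ∀ g : G, HNNExtension.of g ∈ ψ.range → g ∈ G' := by
    rintro g ⟨x, hx⟩
    obtain ⟨g', rfl⟩ := key x ⟨g, hx.symm⟩
    rw [h1] at hx
    rw [← HNNExtension.of_injective _ hx]
    exact g'.2
  refine ⟨⟨ψ, MonoidHom.ext h1, h2, ?_, hr⟩, ?_, ?_⟩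
  · rw [injective_iff_map_eq_one]
    intro x hx
    obtain ⟨g, rfl⟩ := key x (by rw [hx]; exact one_mem _)
    rw [h1, ← map_one HNNExtension.of] at hx
    have : g = 1 := Subtype.ext (HNNExtension.of_injective _ hx)
    rw [this, map_one]
  · rw [← hr]
    ext y
    constructor
    · rintro ⟨hy, g, hg, rfl⟩
      exact ⟨g, ⟨h3 g hy, hg⟩, rfl⟩
    · rintro ⟨g, hg, rfl⟩
      exact ⟨⟨HNNExtension.of ⟨g, hg.1⟩, h1 _⟩, ⟨g, hg.2, rfl⟩⟩
  · rw [← hr]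
    ext y
    constructor
    · rintro ⟨hy, g, rfl⟩
      exact ⟨g, h3 g hy, rfl⟩
    · rintro ⟨g, hg, rfl⟩
      exact ⟨⟨HNNExtension.of ⟨g, hg⟩, h1 _⟩, ⟨g, rfl⟩⟩
end

section
/- Let Γ = G *_A t be the HNN extension of a group G by a stable letter t fixing a subgroup A ≤ G pointwise, and let G' ≤ G be a subgroup with G' ∩ A = {1} (trivial). Then: (1) the subgroup ⟨G', t⟩ of Γ is naturally isomorphic to the ordinary free product G' * ⟨t⟩ of G' with the infinite cyclic group generated by t; and (2) if moreover G' is a free group of rank m, then ⟨G', t⟩ is a free group of rank m + 1. -/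
open Monoid

/-- The natural map from the HNN extension of `G'` over the trivial group. -/
noncomputable def hnnIncl {G : Type} [Group G] (A G' : Subgroup G) :
    HNNExtension ↥G' (⊥ : Subgroup ↥G') ⊥ (MulEquiv.refl _) →*
      HNNExtension G A A (MulEquiv.refl A) :=
  HNNExtension.lift (HNNExtension.of.comp G'.subtype) HNNExtension.t (by
    rintro ⟨a, ha⟩
    obtain rfl := Subgroup.mem_bot.1 ha
    simp)

theorem hnnIncl_injective {G : Type} [Group G] (A G' : Subgroup G) (hA : G' ⊓ A = ⊥) :
    Function.Injective (hnnIncl A G') := by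
  rw [injective_iff_map_eq_one]
  intro x hx
  obtain ⟨d⟩ := HNNExtension.NormalWord.TransversalPair.nonempty ↥G' (⊥ : Subgroup ↥G') ⊥
  obtain ⟨w, rfl⟩ := (HNNExtension.NormalWord.equiv (MulEquiv.refl _) d).symm.surjective x
  change hnnIncl A G' (w.toReducedWord.prod _) = 1 at hx
  change w.toReducedWord.prod _ = 1
  generalize w.toReducedWord = w at hx ⊢
  have hsub : ∀ u : ℤˣ, ∀ g : ↥G', (g : G) ∈ HNNExtension.toSubgroup A A u →
      g ∈ HNNExtension.toSubgroup (⊥ : Subgroup ↥G') ⊥ u := by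
    intro u g hg
    simp only [HNNExtension.toSubgroup, ite_self] at hg ⊢
    have : (g : G) ∈ G' ⊓ A := ⟨g.2, hg⟩
    rw [hA] at this
    exact Subgroup.mem_bot.2 (Subtype.ext (Subgroup.mem_bot.1 this))
  let w' : HNNExtension.NormalWord.ReducedWord G A A :=
    { head := w.head
      toList := w.toList.map (fun p => (p.1, (p.2 : G)))
      chain := by
        rw [List.isChain_map]
        exact w.chain.imp (fun a b h hg => h (hsub _ _ hg)) }
  have hprod : w'.prod (MulEquiv.refl A) = 1 := by
    rw [← hx]
    simp [HNNExtension.NormalWord.ReducedWord.prod, w', hnnIncl, Function.comp_def,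
      map_list_prod]
  have hnil : w'.toList = [] :=
    HNNExtension.ReducedWord.toList_eq_nil_of_mem_of_range _ w' (by rw [hprod]; exact one_mem _)
  have hnil' : w.toList = [] := by simpa [w'] using hnil
  have hh : (w.head : G) = 1 := by
    apply HNNExtension.of_injective (φ := MulEquiv.refl A)
    simpa [HNNExtension.NormalWord.ReducedWord.prod, hnil, w', hnil'] using hprod
  have hh' : w.head = 1 := Subtype.ext hh
  simp [HNNExtension.NormalWord.ReducedWord.prod, hnil', hh']

/-- A free group of rank `m` free product an infinite cyclic group is free of rank `m + 1`. -/
noncomputable def coprodFree (m : ℕ) :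
    Coprod (FreeGroup (Fin m)) (Multiplicative ℤ) ≃* FreeGroup (Fin (m + 1)) :=
  MonoidHom.toMulEquiv
    (Coprod.lift (FreeGroup.map Fin.castSucc) (zpowersHom _ (FreeGroup.of (Fin.last m))))
    (FreeGroup.lift (Fin.lastCases (Coprod.inr (Multiplicative.ofAdd 1))
      (fun i => Coprod.inl (FreeGroup.of i))))
    (by
      apply Coprod.hom_ext
      · ext i
        simp
      · ext
        simp)
    (by
      ext i
      refine Fin.lastCases ?_ (fun i => ?_) i
      · simp
      · simp)

theorem stmt8 (G : Type) [Group G] (A : Subgroup G) (G' : Subgroup G)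
    -- `G' ∩ A` is trivial:
    (hA : G' ⊓ A = ⊥) :
    -- (1) `⟨G', t⟩` is naturally isomorphic to the free product of `G'` with the infinite
    --     cyclic group generated by the stable letter `t`:
    (∃ ψ : Coprod ↥G' (Multiplicative ℤ) →* HNNExtension G A A (MulEquiv.refl A),
      ψ.comp Coprod.inl = HNNExtension.of.comp G'.subtype ∧
      ψ (Coprod.inr (Multiplicative.ofAdd (1 : ℤ))) =
        (HNNExtension.t : HNNExtension G A A (MulEquiv.refl A)) ∧
      Function.Injective ψ ∧
      ψ.range = G'.map (HNNExtension.of : G →* HNNExtension G A A (MulEquiv.refl A)) ⊔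
        Subgroup.zpowers (HNNExtension.t : HNNExtension G A A (MulEquiv.refl A))) ∧
    -- (2) if moreover `G'` is free of rank `m`, then `⟨G', t⟩` is free of rank `m + 1`:
    (∀ m : ℕ, Nonempty (↥G' ≃* FreeGroup (Fin m)) →
      Nonempty
        (↥(G'.map (HNNExtension.of : G →* HNNExtension G A A (MulEquiv.refl A)) ⊔
            Subgroup.zpowers (HNNExtension.t : HNNExtension G A A (MulEquiv.refl A))) ≃*
          FreeGroup (Fin (m + 1)))) := by
  have hex : (∃ ψ : Coprod ↥G' (Multiplicative ℤ) →* HNNExtension G A A (MulEquiv.refl A),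
      ψ.comp Coprod.inl = HNNExtension.of.comp G'.subtype ∧
      ψ (Coprod.inr (Multiplicative.ofAdd (1 : ℤ))) =
        (HNNExtension.t : HNNExtension G A A (MulEquiv.refl A)) ∧
      Function.Injective ψ ∧
      ψ.range = G'.map (HNNExtension.of : G →* HNNExtension G A A (MulEquiv.refl A)) ⊔
        Subgroup.zpowers (HNNExtension.t : HNNExtension G A A (MulEquiv.refl A))) := by
    refine ⟨Coprod.lift (HNNExtension.of.comp G'.subtype) (zpowersHom _ HNNExtension.t),
      Coprod.lift_comp_inl _ _, by simp, ?_, ?_⟩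
    · let α : Coprod ↥G' (Multiplicative ℤ) →*
          HNNExtension ↥G' (⊥ : Subgroup ↥G') ⊥ (MulEquiv.refl _) :=
        Coprod.lift HNNExtension.of (zpowersHom _ HNNExtension.t)
      let β : HNNExtension ↥G' (⊥ : Subgroup ↥G') ⊥ (MulEquiv.refl _) →*
          Coprod ↥G' (Multiplicative ℤ) :=
        HNNExtension.lift Coprod.inl (Coprod.inr (Multiplicative.ofAdd 1)) (by
          rintro ⟨a, ha⟩
          obtain rfl := Subgroup.mem_bot.1 ha
          simp)
      have hβα : β.comp α = MonoidHom.id _ := by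
        apply Coprod.hom_ext
        · ext g
          simp [α, β]
        · ext
          simp [α, β]
      have hα : Function.Injective α :=
        Function.LeftInverse.injective (g := β) (fun x => DFunLike.congr_fun hβα x)
      have hcomp : Coprod.lift (HNNExtension.of.comp G'.subtype) (zpowersHom _ HNNExtension.t) =
          (hnnIncl A G').comp α := by
        apply Coprod.hom_ext
        · ext g
          simp [α, hnnIncl]
        · ext
          simp [α, hnnIncl]
      rw [hcomp]
      exact (hnnIncl_injective A G' hA).comp hα
    · rw [Coprod.range_lift, MonoidHom.range_comp, Subgroup.range_subtype]
      rfl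
  refine ⟨hex, ?_⟩
  rintro m ⟨e⟩
  obtain ⟨ψ, -, -, hinj, hrange⟩ := hex
  rw [← hrange]
  exact ⟨(MonoidHom.ofInjective hinj).symm.trans
    ((MulEquiv.coprodCongr e (MulEquiv.refl _)).trans (coprodFree m))⟩
end

section
/- Let G ≤ M ≤ K_1, …, K_r be groups with K_i ∩ K_j = M for all distinct i, j, let L_i ≤ K_i be subgroups, and set A_i = G ∩ L_i for i = 1, …, r. Then in the group ⋆_{i=1}^r (K_i, L_i, t_i)_M, the subgroup ⟨G, t_1, …, t_r⟩ generated by (the canonical image of) G together with the stable letters t_1, …, t_r is naturally isomorphic to the HNN extension G *_{A_1,…,A_r}(t_1, …, t_r) of G by r stable letters, where t_i fixes A_i pointwise. -/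
open Monoid

/-- The star-construction `⋆_{i=1}^r (K i, L i, t i)_M`: the free product of the HNN
extensions `K i *_{L i} t i` (where the stable letter `t i` fixes `L i` pointwise),
amalgamated along their common subgroup `M` (embedded into `K i` via `μ i`).  It is
realized as the amalgamated product (pushout) of the family of the HNN extensions
along `M`, which coincides with the nested construction
`(⋯((K 1 *_{L 1} t 1) *_M (K 2 *_{L 2} t 2)) *_M ⋯) *_M (K r *_{L r} t r)`. -/
abbrev StarProd {M : Type} [Group M] {r : ℕ} {K : Fin r → Type} [∀ i, Group (K i)]
    (μ : ∀ i, M →* K i) (L : ∀ i, Subgroup (K i)) : Type :=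
  PushoutI (fun i : Fin r =>
    (HNNExtension.of : K i →* HNNExtension (K i) (L i) (L i) (MulEquiv.refl _)).comp (μ i))

/-- The canonical homomorphism of `M` into the star-construction. -/
def StarProd.base {M : Type} [Group M] {r : ℕ} {K : Fin r → Type} [∀ i, Group (K i)]
    (μ : ∀ i, M →* K i) (L : ∀ i, Subgroup (K i)) : M →* StarProd μ L :=
  PushoutI.base _

/-- The canonical homomorphism of the factor `K i` into the star-construction. -/
def StarProd.of {M : Type} [Group M] {r : ℕ} {K : Fin r → Type} [∀ i, Group (K i)]
    (μ : ∀ i, M →* K i) (L : ∀ i, Subgroup (K i)) (i : Fin r) :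
    HNNExtension (K i) (L i) (L i) (MulEquiv.refl _) →* StarProd μ L :=
  PushoutI.of
    (φ := fun i : Fin r =>
      (HNNExtension.of : K i →* HNNExtension (K i) (L i) (L i) (MulEquiv.refl _)).comp (μ i)) i

/-- The stable letter `t i` inside the star-construction. -/
def StarProd.t {M : Type} [Group M] {r : ℕ} {K : Fin r → Type} [∀ i, Group (K i)]
    (μ : ∀ i, M →* K i) (L : ∀ i, Subgroup (K i)) (i : Fin r) : StarProd μ L :=
  StarProd.of μ L i HNNExtension.t

/-- The HNN extension of `G` by stable letters `t i` (`i : Fin r`), where the stable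
letter `t i` fixes the subgroup `A i` pointwise:
`⟨G, t_1, …, t_r | (t i)⁻¹ * a * (t i) = a for all a ∈ A i, i = 1, …, r⟩`. -/
abbrev MultiHNN {G : Type} [Group G] {r : ℕ} (A : Fin r → Subgroup G) : Type :=
  (Coprod G (FreeGroup (Fin r))) ⧸ Subgroup.normalClosure
    {x : Coprod G (FreeGroup (Fin r)) | ∃ (i : Fin r) (a : G), a ∈ A i ∧
      x = (Coprod.inr (FreeGroup.of i))⁻¹ * Coprod.inl a * Coprod.inr (FreeGroup.of i) *
        (Coprod.inl a)⁻¹}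

/-- The canonical homomorphism of the base group `G` into the HNN extension. -/
def MultiHNN.of {G : Type} [Group G] {r : ℕ} (A : Fin r → Subgroup G) :
    G →* MultiHNN A :=
  (QuotientGroup.mk' _).comp Coprod.inl

/-- The stable letters of the HNN extension. -/
def MultiHNN.t {G : Type} [Group G] {r : ℕ} (A : Fin r → Subgroup G) (i : Fin r) :
    MultiHNN A :=
  QuotientGroup.mk' _ (Coprod.inr (FreeGroup.of i))

theorem toSubgroup_self_aux {G : Type} [Group G] (A : Subgroup G) (u : ℤˣ) :
    HNNExtension.toSubgroup A A u = A := by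
  rcases Int.units_eq_one_or u with rfl | rfl <;> rfl

/-- Elements of `HNN(G, L ∩ G)` mapping into `K` come from `G` (Britton's lemma). -/
theorem hnn_mem_range_aux {G K : Type} [Group G] [Group K] (f : G →* K) (L : Subgroup K)
    (F : HNNExtension G (L.comap f) (L.comap f) (MulEquiv.refl _) →*
      HNNExtension K L L (MulEquiv.refl _))
    (hF : ∀ g, F (HNNExtension.of g) = HNNExtension.of (f g))
    (hFt : F HNNExtension.t = HNNExtension.t)
    (x : HNNExtension G (L.comap f) (L.comap f) (MulEquiv.refl _))
    (hx : F x ∈ (HNNExtension.of.range : Subgroup (HNNExtension K L L (MulEquiv.refl _)))) :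
    x ∈ (HNNExtension.of.range :
      Subgroup (HNNExtension G (L.comap f) (L.comap f) (MulEquiv.refl _))) := by
  obtain ⟨d⟩ := HNNExtension.NormalWord.TransversalPair.nonempty G (L.comap f) (L.comap f)
  obtain ⟨w, rfl⟩ := (HNNExtension.NormalWord.equiv (MulEquiv.refl _) d).symm.surjective x
  let w' : HNNExtension.NormalWord.ReducedWord K L L :=
    { head := f w.head
      toList := w.toList.map (fun p => (p.1, f p.2))
      chain := by
        rw [List.isChain_map]
        refine w.chain.imp ?_
        intro a b h h'
        apply h
        rw [toSubgroup_self_aux] at h' ⊢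
        exact h' }
  have hw' : F (w.prod (MulEquiv.refl _)) = w'.prod (MulEquiv.refl _) := by
    simp only [HNNExtension.NormalWord.ReducedWord.prod, map_mul, hF, map_list_prod, w',
      List.map_map]
    congr 3
    funext p
    simp [hF, hFt]
  have h1 : w'.toList = [] := by
    apply HNNExtension.ReducedWord.toList_eq_nil_of_mem_of_range (MulEquiv.refl _)
    rw [← hw']
    exact hx
  have h2 : w.toList = [] := by simpa [w'] using h1
  refine ⟨w.head, ?_⟩
  change _ = w.prod (MulEquiv.refl _)
  simp [HNNExtension.NormalWord.ReducedWord.prod, h2]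

/-- Injectivity of maps between amalgamated products. -/
theorem pushout_injective_aux {ι H H' : Type} [Group H] [Group H'] {X Y : ι → Type}
    [∀ i, Group (X i)] [∀ i, Group (Y i)] (φ : ∀ i, H →* X i) (φ' : ∀ i, H' →* Y i)
    (hφ : ∀ i, Function.Injective (φ i)) (hφ' : ∀ i, Function.Injective (φ' i))
    (θ : H →* H') (hθ : Function.Injective θ) (Θ : ∀ i, X i →* Y i)
    (hmem : ∀ i x, Θ i x ∈ (φ' i).range → x ∈ (φ i).range)
    (F : PushoutI φ →* PushoutI φ')
    (hF : ∀ i x, F (PushoutI.of i x) = PushoutI.of i (Θ i x))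
    (hFb : ∀ h, F (PushoutI.base φ h) = PushoutI.base φ' (θ h)) :
    Function.Injective F := by
  classical
  rw [injective_iff_map_eq_one]
  intro x hx
  obtain ⟨d⟩ := PushoutI.NormalWord.transversal_nonempty φ hφ
  obtain ⟨w, rfl⟩ := (PushoutI.NormalWord.equiv (d := d)).symm.surjective x
  change F w.prod = 1 at hx
  change w.prod = 1
  have hred : ∀ g ∈ w.toList, Θ g.1 g.2 ∉ (φ' g.1).range := by
    intro g hg h
    have h1 := hmem _ _ h
    have h2 := w.normalized g.1 g.2 hg
    apply w.ne_one g hg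
    have h3 := (d.compl g.1).equiv_snd_eq_self_of_mem_of_one_mem (Subgroup.one_mem _) h2
    have h4 := (d.compl g.1).equiv_snd_eq_one_of_mem_of_one_mem (d.one_mem g.1) h1
    rw [h3] at h4
    simpa using h4
  let w' : CoprodI.Word Y :=
    { toList := w.toList.map (fun g => ⟨g.1, Θ g.1 g.2⟩)
      ne_one := by
        intro l hl
        obtain ⟨g, hg, rfl⟩ := List.mem_map.1 hl
        intro h
        apply hred g hg
        change Θ g.1 g.2 = 1 at h
        rw [h]
        exact Subgroup.one_mem _
      chain_ne := by
        rw [List.isChain_map]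
        exact w.chain_ne }
  have hw' : PushoutI.Reduced φ' w' := by
    intro l hl
    obtain ⟨g, hg, rfl⟩ := List.mem_map.1 hl
    exact hred g hg
  have hp : F (PushoutI.ofCoprodI w.toWord.prod) = PushoutI.ofCoprodI w'.prod := by
    simp only [CoprodI.Word.prod, map_list_prod, w', List.map_map]
    congr 2
    funext g
    simp [hF]
  have he : w' = .empty := by
    apply hw'.eq_empty_of_mem_range hφ'
    rw [← hp]
    rw [PushoutI.NormalWord.prod, map_mul, hFb] at hx
    refine ⟨(θ w.head)⁻¹, ?_⟩
    rw [map_inv]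
    exact inv_eq_of_mul_eq_one_right hx
  have he' : w.toList = [] := by
    have := congrArg CoprodI.Word.toList he
    simpa [w', CoprodI.Word.empty] using this
  have hw1 : w.prod = PushoutI.base φ w.head := by
    simp [PushoutI.NormalWord.prod, CoprodI.Word.prod, he']
  rw [hw1, hFb] at hx
  have := PushoutI.base_injective hφ' (hx.trans (map_one _).symm)
  rw [hw1, hθ (this.trans (map_one _).symm), map_one]

/-- Universal property of `MultiHNN`. -/
def MultiHNN.liftAux {G : Type} [Group G] {r : ℕ} (A : Fin r → Subgroup G) {P : Type} [Group P]
    (f : G →* P) (s : Fin r → P) (h : ∀ i, ∀ a ∈ A i, s i * f a = f a * s i) :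
    MultiHNN A →* P :=
  QuotientGroup.lift _ (Coprod.lift f (FreeGroup.lift s)) (by
    change Subgroup.normalClosure _ ≤ MonoidHom.ker _
    apply Subgroup.normalClosure_le_normal
    rintro _ ⟨i, a, ha, rfl⟩
    have h1 : (s i)⁻¹ * f a * s i * (f a)⁻¹ = 1 := by
      rw [mul_assoc (s i)⁻¹, ← h i a ha]
      group
    simpa [MonoidHom.mem_ker] using h1)

theorem MultiHNN.liftAux_of {G : Type} [Group G] {r : ℕ} (A : Fin r → Subgroup G) {P : Type}
    [Group P] (f : G →* P) (s : Fin r → P) (h : ∀ i, ∀ a ∈ A i, s i * f a = f a * s i) (g : G) :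
    MultiHNN.liftAux A f s h (MultiHNN.of A g) = f g := by
  simp [MultiHNN.liftAux, MultiHNN.of]

theorem MultiHNN.liftAux_t {G : Type} [Group G] {r : ℕ} (A : Fin r → Subgroup G) {P : Type}
    [Group P] (f : G →* P) (s : Fin r → P) (h : ∀ i, ∀ a ∈ A i, s i * f a = f a * s i)
    (i : Fin r) :
    MultiHNN.liftAux A f s h (MultiHNN.t A i) = s i := by
  simp [MultiHNN.liftAux, MultiHNN.t]

theorem MultiHNN.comm_aux {G : Type} [Group G] {r : ℕ} (A : Fin r → Subgroup G) (i : Fin r)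
    (a : G) (ha : a ∈ A i) :
    MultiHNN.t A i * MultiHNN.of A a = MultiHNN.of A a * MultiHNN.t A i := by
  have h : (MultiHNN.t A i)⁻¹ * MultiHNN.of A a * MultiHNN.t A i * (MultiHNN.of A a)⁻¹ = 1 := by
    have := (QuotientGroup.eq_one_iff (N := Subgroup.normalClosure
      {x : Coprod G (FreeGroup (Fin r)) | ∃ (i : Fin r) (a : G), a ∈ A i ∧
      x = (Coprod.inr (FreeGroup.of i))⁻¹ * Coprod.inl a * Coprod.inr (FreeGroup.of i) *
        (Coprod.inl a)⁻¹}) _).2 (Subgroup.subset_normalClosure ⟨i, a, ha, rfl⟩)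
    exact this
  rw [mul_inv_eq_one, mul_assoc, inv_mul_eq_iff_eq_mul] at h
  exact h.symm

theorem MultiHNN.hom_ext_aux {G : Type} [Group G] {r : ℕ} (A : Fin r → Subgroup G) {P : Type}
    [Group P] (f g : MultiHNN A →* P) (h : f.comp (MultiHNN.of A) = g.comp (MultiHNN.of A))
    (ht : ∀ i, f (MultiHNN.t A i) = g (MultiHNN.t A i)) : f = g := by
  apply QuotientGroup.monoidHom_ext
  apply Coprod.hom_ext
  · exact h
  · ext i
    exact ht i

theorem MultiHNN.top_aux {G : Type} [Group G] {r : ℕ} (A : Fin r → Subgroup G)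
    (S : Subgroup (MultiHNN A)) (h : ∀ g, MultiHNN.of A g ∈ S) (ht : ∀ i, MultiHNN.t A i ∈ S)
    (x : MultiHNN A) : x ∈ S := by
  let F : MultiHNN A →* S := MultiHNN.liftAux A ((MultiHNN.of A).codRestrict S h)
    (fun i => ⟨MultiHNN.t A i, ht i⟩)
    (fun i a ha => Subtype.ext (MultiHNN.comm_aux A i a ha))
  have : S.subtype.comp F = MonoidHom.id _ := by
    apply MultiHNN.hom_ext_aux
    · ext g
      simp [F, MultiHNN.liftAux_of]
    · intro i
      simp [F, MultiHNN.liftAux_t]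
  have h2 := DFunLike.congr_fun this x
  change (F x : MultiHNN A) = x at h2
  rw [← h2]
  exact (F x).2


theorem stmt10 (G M : Type) [Group G] [Group M] (r : ℕ) (hr : 0 < r)
    (K : Fin r → Type) [∀ i, Group (K i)]
    -- `G ≤ M ≤ K 1, …, K r`:
    (ν : G →* M) (hν : Function.Injective ν)
    (μ : ∀ i, M →* K i) (hμ : ∀ i, Function.Injective (μ i))
    (L : ∀ i, Subgroup (K i)) :
    -- the canonical homomorphism from `G *_{A_1,…,A_r}(t_1,…,t_r)`, where
    -- `A i = G ∩ L i`, to the star-construction, sending `G` to its canonical image and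
    -- the stable letters to the stable letters, is injective with image `⟨G, t_1, …, t_r⟩`:
    ∃ ψ : MultiHNN (fun i => (L i).comap ((μ i).comp ν)) →* StarProd μ L,
      ψ.comp (MultiHNN.of (fun i => (L i).comap ((μ i).comp ν))) =
        (StarProd.base μ L).comp ν ∧
      (∀ i : Fin r, ψ (MultiHNN.t (fun i => (L i).comap ((μ i).comp ν)) i) =
        StarProd.t μ L i) ∧
      Function.Injective ψ ∧
      ψ.range = ((StarProd.base μ L).comp ν).range ⊔
        ⨆ i : Fin r, Subgroup.zpowers (StarProd.t μ L i) := by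
  set A : Fin r → Subgroup G := fun i => (L i).comap ((μ i).comp ν) with hA
  have hbase : ∀ i m, StarProd.base μ L m = StarProd.of μ L i (HNNExtension.of (μ i m)) := by
    intro i m
    exact (PushoutI.of_apply_eq_base (fun i : Fin r => (HNNExtension.of : K i →*
      HNNExtension (K i) (L i) (L i) (MulEquiv.refl _)).comp (μ i)) i m).symm
  have hcomm : ∀ i, ∀ a ∈ A i, StarProd.t μ L i * (StarProd.base μ L).comp ν a =
      (StarProd.base μ L).comp ν a * StarProd.t μ L i := by
    intro i a ha
    rw [MonoidHom.comp_apply, hbase i, StarProd.t, ← map_mul, ← map_mul]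
    congr 1
    exact HNNExtension.t_mul_of (φ := MulEquiv.refl (L i)) ⟨μ i (ν a), ha⟩
  refine ⟨MultiHNN.liftAux A ((StarProd.base μ L).comp ν) (StarProd.t μ L) hcomm, ?_, ?_, ?_, ?_⟩
  · exact MonoidHom.ext fun g => MultiHNN.liftAux_of A _ _ hcomm g
  · intro i
    exact MultiHNN.liftAux_t _ _ _ _ _
  · let φ : ∀ i, G →* HNNExtension G (A i) (A i) (MulEquiv.refl _) := fun i => HNNExtension.of
    let Θ : ∀ i, HNNExtension G (A i) (A i) (MulEquiv.refl _) →*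
        HNNExtension (K i) (L i) (L i) (MulEquiv.refl _) := fun i =>
      HNNExtension.lift (HNNExtension.of.comp ((μ i).comp ν)) HNNExtension.t (by
        intro a
        exact HNNExtension.t_mul_of (φ := MulEquiv.refl (L i)) ⟨μ i (ν a), a.2⟩)
    have hΘ : ∀ i g, Θ i (HNNExtension.of g) = HNNExtension.of (μ i (ν g)) := by
      intro i g
      exact HNNExtension.lift_of _ _ _ _
    have hΘt : ∀ i, Θ i HNNExtension.t = HNNExtension.t := by
      intro i
      exact HNNExtension.lift_t _ _ _
    let F : PushoutI φ →* StarProd μ L := PushoutI.lift (fun i => (StarProd.of μ L i).comp (Θ i))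
      ((StarProd.base μ L).comp ν) (by
        intro i
        ext g
        simp only [MonoidHom.comp_apply, φ, hΘ]
        exact (hbase i _).symm)
    have hFi : Function.Injective F := by
      refine pushout_injective_aux φ _ (fun i => HNNExtension.of_injective _) ?_ ν hν Θ ?_ F ?_ ?_
      · intro i
        exact (HNNExtension.of_injective _).comp (hμ i)
      · rintro i x ⟨m, hm⟩
        exact hnn_mem_range_aux ((μ i).comp ν) (L i) (Θ i) (hΘ i) (hΘt i) x ⟨μ i m, hm⟩
      · intro i x
        exact PushoutI.lift_of _ _ _ _
      · intro h
        exact PushoutI.lift_base _ _ _ _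
    let e : MultiHNN A →* PushoutI φ := MultiHNN.liftAux A (PushoutI.base φ)
      (fun i => PushoutI.of i HNNExtension.t) (by
        intro i a ha
        rw [← PushoutI.of_apply_eq_base φ i, ← map_mul, ← map_mul]
        congr 1
        exact HNNExtension.t_mul_of (φ := MulEquiv.refl (A i)) ⟨a, ha⟩)
    let e' : PushoutI φ →* MultiHNN A := PushoutI.lift
      (fun i => HNNExtension.lift (MultiHNN.of A) (MultiHNN.t A i)
        (fun a => MultiHNN.comm_aux A i a a.2)) (MultiHNN.of A) (by
        intro i
        ext g
        rw [MonoidHom.comp_apply]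
        exact HNNExtension.lift_of _ _ _ _)
    have hee : e'.comp e = MonoidHom.id _ := by
      apply MultiHNN.hom_ext_aux
      · ext g
        simp [e, e', MultiHNN.liftAux_of]
      · intro i
        simp only [e, e', MultiHNN.liftAux_t, MonoidHom.comp_apply, PushoutI.lift_of]
        exact HNNExtension.lift_t _ _ _
    have hei : Function.Injective e :=
      Function.LeftInverse.injective (g := e') (fun x => DFunLike.congr_fun hee x)
    have hc : MultiHNN.liftAux A ((StarProd.base μ L).comp ν) (StarProd.t μ L) hcomm =
        F.comp e := by
      apply MultiHNN.hom_ext_aux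
      · ext g
        simp [e, F, MultiHNN.liftAux_of]
      · intro i
        simp [e, F, MultiHNN.liftAux_t, hΘt, StarProd.t]
    rw [hc]
    exact hFi.comp hei
  · apply le_antisymm
    · rintro _ ⟨x, rfl⟩
      rw [← Subgroup.mem_comap]
      apply MultiHNN.top_aux
      · intro g
        rw [Subgroup.mem_comap, MultiHNN.liftAux_of]
        exact Subgroup.mem_sup_left ⟨g, rfl⟩
      · intro i
        rw [Subgroup.mem_comap, MultiHNN.liftAux_t]
        exact Subgroup.mem_sup_right (Subgroup.mem_iSup_of_mem i (Subgroup.mem_zpowers _))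
    · refine sup_le ?_ (iSup_le fun i => ?_)
      · rintro _ ⟨g, rfl⟩
        exact ⟨MultiHNN.of A g, MultiHNN.liftAux_of _ _ _ _ _⟩
      · rw [Subgroup.zpowers_le]
        exact ⟨MultiHNN.t A i, MultiHNN.liftAux_t _ _ _ _ _⟩
end

section
/- Let A_1, …, A_r be subgroups of a group G with intersection I = ⋂_{i=1}^r A_i, and let Γ = G *_{A_1,…,A_r}(t_1, …, t_r) be the HNN extension of G by stable letters t_1, …, t_r, where t_i fixes A_i pointwise. Then, identifying G with its canonical image in Γ, one has G ∩ G^{t_1 ⋯ t_r} = I, where G^{t_1 ⋯ t_r} = (t_1 ⋯ t_r)⁻¹ G (t_1 ⋯ t_r) is the conjugate of G by the product t_1 ⋯ t_r. -/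
open Monoid

/-- Universal property of the HNN extension. -/
theorem MultiHNN.exists_lift {G : Type} [Group G] {r : ℕ} (A : Fin r → Subgroup G)
    {H : Type} [Group H] (f : G →* H) (x : Fin r → H)
    (hx : ∀ i, ∀ a ∈ A i, f a * x i = x i * f a) :
    ∃ F : MultiHNN A →* H, (∀ g, F (MultiHNN.of A g) = f g) ∧
      ∀ i, F (MultiHNN.t A i) = x i := by
  refine ⟨QuotientGroup.lift _ (Coprod.lift f (FreeGroup.lift x)) ?_, ?_, ?_⟩
  · intro y hy
    have : Subgroup.normalClosure
      {x : Coprod G (FreeGroup (Fin r)) | ∃ (i : Fin r) (a : G), a ∈ A i ∧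
        x = (Coprod.inr (FreeGroup.of i))⁻¹ * Coprod.inl a * Coprod.inr (FreeGroup.of i) *
          (Coprod.inl a)⁻¹} ≤ (Coprod.lift f (FreeGroup.lift x)).ker := by
      apply Subgroup.normalClosure_le_normal
      rintro _ ⟨i, a, ha, rfl⟩
      simp only [SetLike.mem_coe, MonoidHom.mem_ker, map_mul, map_inv, Coprod.lift_apply_inl,
        Coprod.lift_apply_inr, FreeGroup.lift_apply_of]
      rw [mul_inv_eq_one, mul_assoc, hx i a ha, inv_mul_cancel_left]
    exact this hy
  · intro g
    simp [MultiHNN.of]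
  · intro i
    simp [MultiHNN.t]

theorem MultiHNN.commute {G : Type} [Group G] {r : ℕ} (A : Fin r → Subgroup G)
    (i : Fin r) (a : G) (ha : a ∈ A i) :
    Commute (MultiHNN.of A a) (MultiHNN.t A i) := by
  have h : (MultiHNN.t A i)⁻¹ * MultiHNN.of A a * MultiHNN.t A i * (MultiHNN.of A a)⁻¹ = 1 :=
    (QuotientGroup.eq_one_iff _).2 (Subgroup.subset_normalClosure ⟨i, a, ha, rfl⟩)
  rw [mul_inv_eq_one, mul_assoc, inv_mul_eq_iff_eq_mul] at h
  exact h

open Classical in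
/-- A permutation representation of `G` together with a permutation that commutes with
exactly the elements of `A`. -/
theorem exists_perm_test {G : Type} [Group G] (A : Subgroup G) :
    ∃ (f : G →* Equiv.Perm ((G ⧸ A) × Bool)) (s : Equiv.Perm ((G ⧸ A) × Bool)),
      ∀ g, f g * s = s * f g ↔ g ∈ A := by
  let f : G →* Equiv.Perm ((G ⧸ A) × Bool) :=
    { toFun := fun g => (MulAction.toPerm g : Equiv.Perm (G ⧸ A)).prodCongr (Equiv.refl Bool)
      map_one' := by ext x <;> simp
      map_mul' := by intro a b; ext x <;> simp [mul_smul] }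
  have hf : ∀ g (q : G ⧸ A) b, f g (q, b) = (g • q, b) := fun g q b => rfl
  have key : ∀ g : G, g • ((1 : G) : G ⧸ A) = ((1 : G) : G ⧸ A) ↔ g ∈ A := by
    intro g
    rw [MulAction.Quotient.smul_mk, eq_comm, QuotientGroup.eq]
    simp
  refine ⟨f, Equiv.swap (((1 : G) : G ⧸ A), false) (((1 : G) : G ⧸ A), true), fun g => ?_⟩
  constructor
  · intro h
    by_contra hg
    have h1 := congrArg (fun p : Equiv.Perm ((G ⧸ A) × Bool) =>
      p (((1 : G) : G ⧸ A), false)) h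
    simp only [Equiv.Perm.mul_apply, Equiv.swap_apply_left, hf] at h1
    have hne := fun e => hg ((key g).1 e)
    rw [Equiv.swap_apply_of_ne_of_ne] at h1
    · simp at h1
    · intro e; exact hne (congrArg Prod.fst e)
    · intro e; exact hne (congrArg Prod.fst e)
  · intro hg
    have hk := (key g).2 hg
    rw [Equiv.mul_swap_eq_swap_mul, hf, hf, hk]

theorem stmt11 (G : Type) [Group G] (r : ℕ) (A : Fin r → Subgroup G) :
    -- in `Γ = G *_{A_1,…,A_r}(t_1,…,t_r)` one has
    -- `G ∩ G^{t_1 ⋯ t_r} = ⋂ i, A i`: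
    (MultiHNN.of A).range ⊓
      ((MultiHNN.of A).range.map
        ((MulAut.conj ((List.ofFn (MultiHNN.t A)).prod)⁻¹).toMonoidHom)) =
      (⨅ i, A i).map (MultiHNN.of A) := by
  have hprod : ∀ (H : Type) [Group H] (F : MultiHNN A →* H),
      F (List.ofFn (MultiHNN.t A)).prod = (List.ofFn fun i => F (MultiHNN.t A i)).prod := by
    intro H _ F
    rw [map_list_prod, List.map_ofFn]
    rfl
  ext y
  simp only [Subgroup.mem_inf, MonoidHom.mem_range, Subgroup.mem_map, Subgroup.mem_iInf]
  constructor
  · rintro ⟨⟨g, rfl⟩, ⟨_, ⟨h, rfl⟩, hc⟩⟩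
    refine ⟨g, ?_, rfl⟩
    simp only [MulEquiv.coe_toMonoidHom, MulAut.conj_apply, inv_inv, mul_assoc,
      inv_mul_eq_iff_eq_mul] at hc
    obtain ⟨R, hR1, hR2⟩ := MultiHNN.exists_lift A (MonoidHom.id G) (fun _ => 1) (by simp)
    have hgh := congrArg R hc
    rw [map_mul, map_mul, hprod] at hgh
    simp only [hR1, hR2] at hgh
    simp at hgh
    subst hgh
    intro i
    obtain ⟨f, s, hs⟩ := exists_perm_test (A i)
    obtain ⟨F, hF1, hF2⟩ := MultiHNN.exists_lift A f (fun j => if j = i then s else 1) (by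
      intro j a ha
      by_cases hj : j = i
      · subst hj
        simpa using (hs a).2 ha
      · simp [hj])
    have h1 := congrArg F hc
    rw [map_mul, map_mul, hprod] at h1
    simp only [hF1, hF2] at h1
    have h2 : (List.ofFn fun j => if j = i then s else 1).prod = s := by
      rw [List.ofFn_eq_map, List.prod_map_eq_pow_single i _ (by intro j hj _; simp [hj]),
        List.count_eq_one_of_mem (List.nodup_finRange r) (List.mem_finRange i)]
      simp
    rw [h2] at h1
    exact (hs _).1 h1
  · rintro ⟨g, hg, rfl⟩
    refine ⟨⟨g, rfl⟩, MultiHNN.of A g, ⟨g, rfl⟩, ?_⟩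
    have hcomm : Commute (MultiHNN.of A g) (List.ofFn (MultiHNN.t A)).prod := by
      apply Commute.list_prod_right
      intro x hx
      obtain ⟨i, rfl⟩ := (List.mem_ofFn' _ _).1 hx
      exact MultiHNN.commute A i g (hg i)
    simp only [MulEquiv.coe_toMonoidHom, MulAut.conj_apply, inv_inv, mul_assoc,
      inv_mul_eq_iff_eq_mul]
    exact hcomm
end

section
/- Let A_1, …, A_r be subgroups of a group G with join J = ⟨⋃_{i=1}^r A_i⟩, and let Γ = G *_{A_1,…,A_r}(t_1, …, t_r) be the HNN extension of G by stable letters t_1, …, t_r, where t_i fixes A_i pointwise. Then, identifying G with its canonical image in Γ, one has G ∩ ⟨⋃_{i=1}^r G^{t_i}⟩ = J, where G^{t_i} = t_i⁻¹ G t_i. -/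
open Monoid

/-- The action of `G` on the cosets of `J` with an extra fixed point. -/
def cosetPerm {G : Type} [Group G] (J : Subgroup G) : G →* Equiv.Perm (Option (G ⧸ J)) where
  toFun g := Equiv.optionCongr (MulAction.toPerm g)
  map_one' := by ext1 x; cases x <;> simp
  map_mul' a b := by ext1 x; cases x <;> simp [mul_smul]

theorem stmt12 (G : Type) [Group G] (r : ℕ) (A : Fin r → Subgroup G) :
    -- in `Γ = G *_{A_1,…,A_r}(t_1,…,t_r)` one has
    -- `G ∩ ⟨⋃ i, G^{t i}⟩ = ⟨⋃ i, A i⟩`: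
    (MultiHNN.of A).range ⊓
      (⨆ i : Fin r, (MultiHNN.of A).range.map
        ((MulAut.conj (MultiHNN.t A i)⁻¹).toMonoidHom)) =
      (⨆ i, A i).map (MultiHNN.of A) := by
  classical
  apply le_antisymm
  · rintro _ ⟨⟨g, rfl⟩, hg⟩
    set J : Subgroup G := ⨆ i, A i with hJ
    let p : Option (G ⧸ J) := some ((1 : G) : G ⧸ J)
    let s : Equiv.Perm (Option (G ⧸ J)) := Equiv.swap p none
    let F : Coprod G (FreeGroup (Fin r)) →* Equiv.Perm (Option (G ⧸ J)) :=
      Coprod.lift (cosetPerm J) (FreeGroup.lift fun _ => s)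
    have hnone : ∀ g : G, cosetPerm J g none = none := fun g => by simp [cosetPerm]
    have hp : ∀ g : G, cosetPerm J g p = p ↔ g ∈ J := fun g => by
      have : cosetPerm J g p = some ((g : G) : G ⧸ J) := by
        simp [cosetPerm, p, MulAction.Quotient.smul_coe]
      rw [this, Option.some_inj, eq_comm, QuotientGroup.eq]
      simp
    have hcomm : ∀ a ∈ J, s⁻¹ * cosetPerm J a * s * (cosetPerm J a)⁻¹ = 1 := by
      intro a ha
      have h := Equiv.swap_apply_apply (cosetPerm J a) p none
      rw [(hp a).2 ha, hnone] at h
      have h2 : s * cosetPerm J a = cosetPerm J a * s := by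
        change s = _ * s * _ at h
        nth_rewrite 1 [h]
        group
      rw [mul_assoc s⁻¹, ← h2]
      group
    have hF : Subgroup.normalClosure
        {x : Coprod G (FreeGroup (Fin r)) | ∃ (i : Fin r) (a : G), a ∈ A i ∧
          x = (Coprod.inr (FreeGroup.of i))⁻¹ * Coprod.inl a * Coprod.inr (FreeGroup.of i) *
            (Coprod.inl a)⁻¹} ≤ F.ker := by
      apply Subgroup.normalClosure_le_normal
      rintro _ ⟨i, a, ha, rfl⟩
      have := hcomm a (le_iSup A i ha)
      simpa [F, MonoidHom.mem_ker] using this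
    let Φ : MultiHNN A →* Equiv.Perm (Option (G ⧸ J)) := QuotientGroup.lift _ F hF
    have hof : ∀ g, Φ (MultiHNN.of A g) = cosetPerm J g := fun g => by
      change F (Coprod.inl g) = _
      simp [F]
    have ht : ∀ i, Φ (MultiHNN.t A i) = s := fun i => by
      change F (Coprod.inr (FreeGroup.of i)) = _
      simp [F]
    have key : (⨆ i : Fin r, (MultiHNN.of A).range.map
        ((MulAut.conj (MultiHNN.t A i)⁻¹).toMonoidHom)) ≤
        (MulAction.stabilizer (Equiv.Perm (Option (G ⧸ J))) p).comap Φ := by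
      apply iSup_le
      rintro i _ ⟨_, ⟨h, rfl⟩, rfl⟩
      simp only [Subgroup.mem_comap, MulAction.mem_stabilizer_iff]
      simp [hof, ht, s, hnone]
    have h1 := key hg
    rw [Subgroup.mem_comap, hof, MulAction.mem_stabilizer_iff] at h1
    exact ⟨g, (hp g).1 h1, rfl⟩
  · rw [Subgroup.map_le_iff_le_comap]
    apply iSup_le
    intro i a ha
    refine ⟨⟨a, rfl⟩, ?_⟩
    refine (le_iSup (fun i : Fin r => (MultiHNN.of A).range.map
        ((MulAut.conj (MultiHNN.t A i)⁻¹).toMonoidHom)) i) ⟨MultiHNN.of A a, ⟨a, rfl⟩, ?_⟩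
    have h : (MultiHNN.t A i)⁻¹ * MultiHNN.of A a * MultiHNN.t A i * (MultiHNN.of A a)⁻¹ = 1 :=
      (QuotientGroup.eq_one_iff _).2 (Subgroup.subset_normalClosure ⟨i, a, ha, rfl⟩)
    simpa using mul_inv_eq_one.1 h
end

section
/- If A_1, …, A_r are benign subgroups of a finitely generated group G, then their intersection I = ⋂_{i=1}^r A_i is also a benign subgroup of G. -/
/-- A group is finitely presented if it admits a presentation with finitely many
generators and finitely many defining relations. -/
def FinitelyPresentedGroup (G : Type) [Group G] : Prop :=
  ∃ (n : ℕ) (S : Finset (FreeGroup (Fin n))),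
    Nonempty (G ≃* (FreeGroup (Fin n) ⧸ Subgroup.normalClosure (S : Set (FreeGroup (Fin n)))))

/-- A subgroup `H` of a group `G` is *benign* in `G` if there are a finitely presented
group `K`, an embedding `ι : G →* K` and a finitely generated subgroup `L ≤ K` such
that, identifying `G` and `H` with their images in `K`, one has `G ∩ L = H`. -/
def Benign {G : Type} [Group G] (H : Subgroup G) : Prop :=
  ∃ (K : Type) (_ : Group K) (ι : G →* K) (L : Subgroup K),
    Function.Injective ι ∧ FinitelyPresentedGroup K ∧ L.FG ∧ ι.range ⊓ L = H.map ι

theorem fp_iff (G : Type) [Group G] :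
    FinitelyPresentedGroup G ↔ Group.IsFinitelyPresented G := by
  constructor
  · rintro ⟨n, S, ⟨e⟩⟩
    have : Group.IsFinitelyPresented
        (FreeGroup (Fin n) ⧸ Subgroup.normalClosure (S : Set (FreeGroup (Fin n)))) :=
      Group.IsFinitelyPresented.quotient _ ⟨S, S.finite_toSet, rfl⟩
    exact Group.IsFinitelyPresented.equiv e.symm
  · intro h
    obtain ⟨n, s, hs, ⟨e⟩⟩ := Group.IsFinitelyPresented.exists_mulEquiv_presentedGroup (G := G)
    obtain ⟨S, rfl⟩ := hs.exists_finset_coe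
    exact ⟨n, S, ⟨e⟩⟩

open Monoid in
theorem pushout_fp {H : Type} [Group H] (K : Bool → Type) [∀ b, Group (K b)]
    (φ : ∀ b, H →* K b) (hH : Group.FG H)
    (h1 : Group.IsFinitelyPresented (K true)) (h2 : Group.IsFinitelyPresented (K false)) :
    Group.IsFinitelyPresented (PushoutI φ) := by
  let f : Coprod (K true) (K false) →* PushoutI φ :=
    Coprod.lift (PushoutI.of true) (PushoutI.of false)
  obtain ⟨T, hT⟩ := hH.out
  let g1 : H →* Coprod (K true) (K false) := Coprod.inl.comp (φ true)
  let g2 : H →* Coprod (K true) (K false) := Coprod.inr.comp (φ false)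
  let R : Set (Coprod (K true) (K false)) := (fun h => g1 h * (g2 h)⁻¹) '' (T : Set H)
  let N := Subgroup.normalClosure R
  let q : Coprod (K true) (K false) →* (Coprod (K true) (K false) ⧸ N) := QuotientGroup.mk' N
  have hq : q.comp g1 = q.comp g2 := by
    refine MonoidHom.eq_of_eqOn_dense hT ?_
    intro h hh
    have : g1 h * (g2 h)⁻¹ ∈ N := Subgroup.subset_normalClosure ⟨h, hh, rfl⟩
    have : q (g1 h * (g2 h)⁻¹) = 1 := (QuotientGroup.eq_one_iff _).2 this
    rw [map_mul, map_inv, mul_inv_eq_one] at this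
    exact this
  let F : ∀ b, K b →* (Coprod (K true) (K false) ⧸ N) := fun b =>
    match b with
    | true => q.comp Coprod.inl
    | false => q.comp Coprod.inr
  let ψ : PushoutI φ →* (Coprod (K true) (K false) ⧸ N) :=
    PushoutI.lift F (q.comp g1) (by
      rintro (_ | _)
      · exact hq.symm
      · rfl)
  have hψ : ψ.comp f = q := by
    refine Coprod.hom_ext ?_ ?_
    · ext x
      simp [ψ, f, F]
    · ext x
      simp [ψ, f, F]
  refine Group.IsFinitelyPresented.of_surjective f ?_ ⟨R, T.finite_toSet.image _, ?_⟩
  · intro x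
    rw [← MonoidHom.mem_range]
    induction x using PushoutI.induction_on with
    | of i g =>
      cases i
      · exact ⟨Coprod.inr g, by simp [f]⟩
      · exact ⟨Coprod.inl g, by simp [f]⟩
    | base h => exact ⟨Coprod.inl (φ true h), by simp [f, PushoutI.of_apply_eq_base]⟩
    | mul x y hx hy => exact mul_mem hx hy
  · apply le_antisymm
    · refine Subgroup.normalClosure_le_normal ?_
      rintro _ ⟨h, _, rfl⟩
      simp [f, g1, g2, MonoidHom.mem_ker, PushoutI.of_apply_eq_base]
    · intro x hx
      have : q x = 1 := by
        rw [← hψ, MonoidHom.comp_apply, MonoidHom.mem_ker.1 hx, map_one]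
      exact (QuotientGroup.eq_one_iff _).1 this

/-- The two factors of an amalgamated product, as a family indexed by `Bool`. -/
def AmalgamFam (K₁ K₂ : Type) : Bool → Type
  | true => K₁
  | false => K₂

instance amalgamFamGroup (K₁ K₂ : Type) [i₁ : Group K₁] [i₂ : Group K₂] :
    ∀ b, Group (AmalgamFam K₁ K₂ b)
  | true => i₁
  | false => i₂

/-- The two maps into the factors, as a family indexed by `Bool`. -/
def amalgamHom {H K₁ K₂ : Type} [Group H] [Group K₁] [Group K₂]
    (f₁ : H →* K₁) (f₂ : H →* K₂) : ∀ b, H →* AmalgamFam K₁ K₂ b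
  | true => f₁
  | false => f₂

/-- Amalgamated products of finitely presented groups over a finitely generated group. -/
theorem amalgam {H K₁ K₂ : Type} [Group H] [Group K₁] [Group K₂]
    (f₁ : H →* K₁) (f₂ : H →* K₂) (hf₁ : Function.Injective f₁) (hf₂ : Function.Injective f₂)
    (hH : Group.FG H) (h1 : Group.IsFinitelyPresented K₁) (h2 : Group.IsFinitelyPresented K₂) :
    ∃ (P : Type) (_ : Group P) (j₁ : K₁ →* P) (j₂ : K₂ →* P),
      Function.Injective j₁ ∧ Function.Injective j₂ ∧ Group.IsFinitelyPresented P ∧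
      (∀ h, j₁ (f₁ h) = j₂ (f₂ h)) ∧
      ∀ x y, j₁ x = j₂ y → ∃ h, f₁ h = x ∧ f₂ h = y := by
  let φ : ∀ b, H →* AmalgamFam K₁ K₂ b := amalgamHom f₁ f₂
  have hφ : ∀ b, Function.Injective (φ b) := by
    rintro (_ | _)
    · exact hf₂
    · exact hf₁
  have i1 := Monoid.PushoutI.of_injective hφ true
  have i2 := Monoid.PushoutI.of_injective hφ false
  refine ⟨Monoid.PushoutI φ, inferInstance, Monoid.PushoutI.of (φ := φ) true,
    Monoid.PushoutI.of (φ := φ) false, i1, i2, pushout_fp (AmalgamFam K₁ K₂) φ hH h1 h2, ?_, ?_⟩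
  · intro h
    exact (Monoid.PushoutI.of_apply_eq_base φ true h).trans
      (Monoid.PushoutI.of_apply_eq_base φ false h).symm
  · intro x y hxy
    have hmem : Monoid.PushoutI.of (φ := φ) true x ∈ (Monoid.PushoutI.base φ).range := by
      rw [← Monoid.PushoutI.inf_of_range_eq_base_range hφ (i := true) (j := false) (by decide)]
      exact ⟨⟨x, rfl⟩, ⟨y, hxy.symm⟩⟩
    obtain ⟨h, hh⟩ := hmem
    refine ⟨h, i1 ?_, i2 ?_⟩
    · exact (Monoid.PushoutI.of_apply_eq_base φ true h).trans hh
    · exact (Monoid.PushoutI.of_apply_eq_base φ false h).trans (hh.trans hxy)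

/-- A benign subgroup is the intersection of two copies of the group in a finitely presented
group. -/
theorem Benign.double {G : Type} [Group G] {A : Subgroup G} (hA : Benign A) :
    ∃ (P : Type) (_ : Group P) (u v : G →* P), Function.Injective u ∧ Function.Injective v ∧
      Group.IsFinitelyPresented P ∧ (∀ a ∈ A, u a = v a) ∧
      ∀ x y, u x = v y → x = y ∧ x ∈ A := by
  obtain ⟨K, _, ι, L, hι, hK, hL, hint⟩ := hA
  rw [fp_iff] at hK
  obtain ⟨P, _, j₁, j₂, hj₁, hj₂, hP, hc, hd⟩ := amalgam L.subtype L.subtype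
    L.subtype_injective L.subtype_injective ((Group.fg_iff_subgroup_fg L).2 hL) hK hK
  refine ⟨P, inferInstance, j₁.comp ι, j₂.comp ι, hj₁.comp hι, hj₂.comp hι, hP, ?_, ?_⟩
  · intro a ha
    have : ι a ∈ ι.range ⊓ L := hint ▸ Subgroup.mem_map_of_mem ι ha
    exact hc ⟨ι a, this.2⟩
  · intro x y hxy
    obtain ⟨h, hx, hy⟩ := hd _ _ hxy
    refine ⟨hι (hx.symm.trans hy), ?_⟩
    have : ι x ∈ A.map ι := by
      rw [← hint]
      exact ⟨⟨x, rfl⟩, hx ▸ h.2⟩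
    obtain ⟨a, ha, hax⟩ := this
    exact hι hax ▸ ha

theorem Benign.inf {G : Type} [Group G] (hG : Group.FG G) {A B : Subgroup G}
    (hA : Benign A) (hB : Benign B) : Benign (A ⊓ B) := by
  obtain ⟨P₁, _, u₁, v₁, hu₁, hv₁, hP₁, hc₁, hd₁⟩ := hA.double
  obtain ⟨P₂, _, u₂, v₂, hu₂, hv₂, hP₂, hc₂, hd₂⟩ := hB.double
  obtain ⟨P, _, j₁, j₂, hj₁, hj₂, hP, hc, hd⟩ := amalgam u₁ u₂ hu₁ hu₂ hG hP₁ hP₂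
  refine ⟨P, inferInstance, j₁.comp v₁, (j₂.comp v₂).range, hj₁.comp hv₁, (fp_iff P).2 hP, ?_, ?_⟩
  · rw [← Group.fg_iff_subgroup_fg]
    exact Group.fg_range _
  · ext z
    constructor
    · rintro ⟨⟨x, rfl⟩, ⟨y, hy⟩⟩
      obtain ⟨h, h1, h2⟩ := hd _ _ hy.symm
      obtain ⟨rfl, hA'⟩ := hd₁ _ _ h1
      exact ⟨h, ⟨hA', (hd₂ _ _ h2).2⟩, rfl⟩
    · rintro ⟨x, ⟨hxA, hxB⟩, rfl⟩
      refine ⟨⟨x, rfl⟩, ⟨x, ?_⟩⟩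
      change j₂ (v₂ x) = j₁ (v₁ x)
      rw [← hc₁ x hxA, ← hc₂ x hxB, hc]

theorem stmt13 (G : Type) [Group G] (hG : Group.FG G)
    (r : ℕ) (hr : 0 < r) (A : Fin r → Subgroup G) (hA : ∀ i, Benign (A i)) :
    Benign (⨅ i, A i) := by
  obtain ⟨n, rfl⟩ : ∃ n, r = n + 1 := ⟨r - 1, by omega⟩
  clear hr
  induction n with
  | zero =>
    have : (⨅ i, A i) = A 0 := le_antisymm (iInf_le _ _) (le_iInf fun i => by
      have : i = 0 := by omega
      rw [this])
    rw [this]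
    exact hA 0
  | succ n ih =>
    have : (⨅ i, A i) = A 0 ⊓ ⨅ i : Fin (n + 1), A i.succ := by
      refine le_antisymm (le_inf (iInf_le _ _) (le_iInf fun i => iInf_le _ _))
        (le_iInf fun i => ?_)
      refine Fin.cases inf_le_left (fun j => ?_) i
      exact inf_le_right.trans (iInf_le (fun k : Fin (n + 1) => A k.succ) j)
    rw [this]
    exact (hA 0).inf hG (ih _ fun i => hA i.succ)
end

section
/- Let A_1, …, A_r be subgroups of a group G such that the canonical homomorphism from the free product A_1 * ⋯ * A_r to G (restricting to the inclusion on each A_i) is injective, i.e., the join of A_1, …, A_r in G is their free product. Let Γ = G *_{A_1,…,A_r}(t_1, …, t_r) be the HNN extension of G by stable letters t_1, …, t_r, where t_i fixes A_i pointwise. Then in Γ the subgroups G^{t_1}, …, G^{t_r} generate their free product: the canonical homomorphism G^{t_1} * ⋯ * G^{t_r} → Γ is injective with image ⟨⋃_{i=1}^r G^{t_i}⟩, where G^{t_i} = t_i⁻¹ G t_i. -/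
open Monoid

theorem aux_map_injective {ι : Type} {M N : ι → Type} [∀ i, Group (M i)] [∀ i, Group (N i)]
    (f : ∀ i, M i →* N i) (hf : ∀ i, Function.Injective (f i)) :
    Function.Injective
      (CoprodI.lift (fun i => (CoprodI.of (i := i)).comp (f i)) : CoprodI M →* CoprodI N) := by
  classical
  rw [injective_iff_map_eq_one]
  intro x hx
  obtain ⟨w, rfl⟩ : ∃ w : CoprodI.Word M, w.prod = x :=
    ⟨CoprodI.Word.equiv x, CoprodI.Word.equiv.symm_apply_apply x⟩
  let w' : CoprodI.Word N :=
    { toList := w.toList.map (fun p => ⟨p.1, f p.1 p.2⟩)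
      ne_one := by
        intro l hl
        obtain ⟨p, hp, rfl⟩ := List.mem_map.1 hl
        intro h
        exact w.ne_one p hp ((injective_iff_map_eq_one (f p.1)).1 (hf p.1) _ h)
      chain_ne := by
        rw [List.isChain_map]
        exact w.chain_ne }
  have h1 : w'.prod = 1 := by
    rw [← hx]
    simp [CoprodI.Word.prod, w', map_list_prod, Function.comp_def]
  have h2 : w' = CoprodI.Word.empty := by
    apply CoprodI.Word.equiv.symm.injective
    exact h1.trans CoprodI.Word.prod_empty.symm
  have h3 : w.toList = [] := by
    have : w'.toList = [] := by rw [h2]; rfl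
    simpa [w'] using this
  simp [CoprodI.Word.prod, h3]

/-- The two-element family of groups used to form the amalgam. -/
def AuxF (G₁ G₂ : Type) : Bool → Type
  | false => G₂
  | true => G₁

instance auxFGroup (G₁ G₂ : Type) [h₁ : Group G₁] [h₂ : Group G₂] : ∀ b, Group (AuxF G₁ G₂ b)
  | false => h₂
  | true => h₁

theorem aux_amalgam {H G₁ G₂ : Type} [Group H] [Group G₁] [Group G₂]
    (φ₁ : H →* G₁) (φ₂ : H →* G₂) (h₁ : Function.Injective φ₁) (h₂ : Function.Injective φ₂) :
    ∃ (K : Type) (_ : Group K) (f₁ : G₁ →* K) (f₂ : G₂ →* K),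
      Function.Injective f₁ ∧ Function.Injective f₂ ∧ ∀ x, f₁ (φ₁ x) = f₂ (φ₂ x) := by
  let φ : ∀ b, H →* AuxF G₁ G₂ b := by
    intro b
    cases b
    · exact φ₂
    · exact φ₁
  have hφ : ∀ b, Function.Injective (φ b) := by
    rintro (_ | _)
    · exact h₂
    · exact h₁
  refine ⟨PushoutI φ, inferInstance, PushoutI.of (φ := φ) true, PushoutI.of (φ := φ) false,
    PushoutI.of_injective hφ true, PushoutI.of_injective hφ false, fun x => ?_⟩
  exact (PushoutI.of_apply_eq_base φ true x).trans (PushoutI.of_apply_eq_base φ false x).symm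

theorem aux_hnn {ι G K₀ : Type} [Group G] [Group K₀] (α β : ι → G →* K₀)
    (hα : ∀ i, Function.Injective (α i)) (hβ : ∀ i, Function.Injective (β i)) (s : Finset ι) :
    ∃ (K : Type) (_ : Group K) (f : K₀ →* K), Function.Injective f ∧
      ∀ i ∈ s, ∃ t : K, ∀ g, t⁻¹ * f (α i g) * t = f (β i g) := by
  classical
  induction s using Finset.induction_on with
  | empty => exact ⟨K₀, inferInstance, MonoidHom.id _, fun _ _ h => h, by simp⟩
  | insert j s hj ih =>
    obtain ⟨K, _, f, hf, h⟩ := ih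
    have ha : Function.Injective (f.comp (α j)) := hf.comp (hα j)
    have hb : Function.Injective (f.comp (β j)) := hf.comp (hβ j)
    let e : (f.comp (β j)).range ≃* (f.comp (α j)).range :=
      (MonoidHom.ofInjective hb).symm.trans (MonoidHom.ofInjective ha)
    refine ⟨HNNExtension K _ _ e, inferInstance, HNNExtension.of.comp f,
      (HNNExtension.of_injective (φ := e)).comp hf, ?_⟩
    intro i hi
    rcases Finset.mem_insert.1 hi with rfl | hi
    · refine ⟨HNNExtension.t, fun g => ?_⟩
      have := HNNExtension.equiv_symm_eq_conj (φ := e) (MonoidHom.ofInjective ha g)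
      have h2 : e.symm (MonoidHom.ofInjective ha g) = MonoidHom.ofInjective hb g := by simp [e]
      rw [h2] at this
      exact this.symm
    · obtain ⟨t, ht⟩ := h i hi
      refine ⟨HNNExtension.of t, fun g => ?_⟩
      simp [← ht g]

theorem stmt15 (G : Type) [Group G] (r : ℕ) (A : Fin r → Subgroup G)
    -- the join of `A_1, …, A_r` in `G` is their free product:
    (hfree : Function.Injective
      (CoprodI.lift (fun i : Fin r => (A i).subtype) : CoprodI (fun i => ↥(A i)) →* G)) :
    -- the canonical homomorphism `G^{t_1} * ⋯ * G^{t_r} →* Γ` is injective …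
    Function.Injective
      (CoprodI.lift (fun i : Fin r =>
          ((MulAut.conj (MultiHNN.t A i)⁻¹).toMonoidHom.comp (MultiHNN.of A))) :
        CoprodI (fun _ : Fin r => G) →* MultiHNN A) ∧
    -- … with image the join `⟨⋃ i, G^{t i}⟩`:
    (CoprodI.lift (fun i : Fin r =>
        ((MulAut.conj (MultiHNN.t A i)⁻¹).toMonoidHom.comp (MultiHNN.of A))) :
      CoprodI (fun _ : Fin r => G) →* MultiHNN A).range =
      ⨆ i : Fin r, (MultiHNN.of A).range.map
        ((MulAut.conj (MultiHNN.t A i)⁻¹).toMonoidHom) := by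
  constructor
  · have hm := aux_map_injective (fun i : Fin r => (A i).subtype)
      (fun i => (A i).subtype_injective)
    obtain ⟨K₀, _, p, q, hp, hq, hpq⟩ := aux_amalgam _ _ hfree hm
    obtain ⟨K, _, f, hf, ht⟩ := aux_hnn (fun _ : Fin r => p)
      (fun i => q.comp (CoprodI.of (M := fun _ : Fin r => G) (i := i))) (fun _ => hp)
      (fun i => hq.comp (CoprodI.of_injective i)) Finset.univ
    choose t ht using fun i => ht i (Finset.mem_univ i)
    let Φ : MultiHNN A →* K := QuotientGroup.lift _
      (Coprod.lift (f.comp p) (FreeGroup.lift t)) (by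
        apply Subgroup.normalClosure_le_normal
        rintro _ ⟨i, a, ha, rfl⟩
        have h := hpq (CoprodI.of (i := i) (⟨a, ha⟩ : A i))
        simp only [CoprodI.lift_of, MonoidHom.comp_apply, Subgroup.subtype_apply] at h
        have h2 := ht i a
        simp only [MonoidHom.comp_apply] at h2
        simp [MonoidHom.mem_ker, h2, ← h])
    have hΦo : ∀ g, Φ (MultiHNN.of A g) = f (p g) := fun g => by
      simp [Φ, MultiHNN.of]
    have hΦt : ∀ i, Φ (MultiHNN.t A i) = t i := fun i => by
      simp [Φ, MultiHNN.t]
    refine Function.Injective.of_comp (f := Φ) ?_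
    rw [← MonoidHom.coe_comp]
    have : Φ.comp (CoprodI.lift (fun i : Fin r =>
          ((MulAut.conj (MultiHNN.t A i)⁻¹).toMonoidHom.comp (MultiHNN.of A)))) = f.comp q := by
      apply CoprodI.ext_hom
      intro i
      ext g
      simpa [hΦo, hΦt] using ht i g
    rw [this]
    exact hf.comp hq
  · rw [CoprodI.range_eq_iSup]
    simp only [MonoidHom.range_comp]
end

section
/- Let F = ⟨b, c⟩ be the free group of rank 2, and for i ∈ ℤ set b_i = c^{-i} b c^{i}. For a fixed m ∈ ℤ, let ξ_m and ξ'_m be the injective endomorphisms of F determined by ξ_m(b) = b_{-m+1}, ξ'_m(b) = b_{-m}, ξ_m(c) = ξ'_m(c) = c², and let Ξ_m = F *_{ξ_m, ξ'_m}(t_m, t'_m) be the HNN extension of F by two stable letters with t_m⁻¹ w t_m = ξ_m(w) and (t'_m)⁻¹ w t'_m = ξ'_m(w) for all w ∈ F. Then, identifying F with its canonical image in Ξ_m, the following equalities of subgroups of Ξ_m hold: F ∩ ⟨b_m, t_m, t'_m⟩ = ⟨b_m, b_{m+1}, b_{m+2}, …⟩ and F ∩ ⟨b_{m-1}, t_m,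 t'_m⟩ = ⟨b_{m-1}, b_{m-2}, b_{m-3}, …⟩, where ⟨b_m, b_{m+1}, …⟩ denotes the subgroup generated by all b_i with i ≥ m and ⟨b_{m-1}, b_{m-2}, …⟩ the subgroup generated by all b_i with i ≤ m−1. -/
open Monoid

/-- The HNN extension of `G` by two stable letters `t₁, t₂` with respect to two injective
endomorphisms `f, g` of `G` (regarded as isomorphisms onto their images):
`⟨G, t₁, t₂ | t₁⁻¹ * a * t₁ = f a, t₂⁻¹ * a * t₂ = g a for all a ∈ G⟩`. -/
abbrev HNN2 {G : Type} [Group G] (f g : G →* G) : Type :=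
  (Coprod G (FreeGroup Bool)) ⧸ Subgroup.normalClosure
    {x : Coprod G (FreeGroup Bool) |
      (∃ a : G, x = (Coprod.inr (FreeGroup.of false))⁻¹ * Coprod.inl a *
        Coprod.inr (FreeGroup.of false) * (Coprod.inl (f a))⁻¹) ∨
      (∃ a : G, x = (Coprod.inr (FreeGroup.of true))⁻¹ * Coprod.inl a *
        Coprod.inr (FreeGroup.of true) * (Coprod.inl (g a))⁻¹)}

/-- The canonical homomorphism of the base group into the HNN extension. -/
def HNN2.of {G : Type} [Group G] (f g : G →* G) : G →* HNN2 f g :=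
  (QuotientGroup.mk' _).comp Coprod.inl

/-- The first stable letter. -/
def HNN2.t₁ {G : Type} [Group G] (f g : G →* G) : HNN2 f g :=
  QuotientGroup.mk' _ (Coprod.inr (FreeGroup.of false))

/-- The second stable letter. -/
def HNN2.t₂ {G : Type} [Group G] (f g : G →* G) : HNN2 f g :=
  QuotientGroup.mk' _ (Coprod.inr (FreeGroup.of true))

/-- The generator `b` of the free group `F = ⟨b, c⟩` of rank 2. -/
def bb : FreeGroup (Fin 2) := FreeGroup.of 0

/-- The generator `c` of the free group `F = ⟨b, c⟩` of rank 2. -/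
def cc : FreeGroup (Fin 2) := FreeGroup.of 1

/-- The element `b_i = c^{-i} * b * c^i` of `F`, for `i : ℤ`. -/
def bseq (i : ℤ) : FreeGroup (Fin 2) := cc ^ (-i) * bb * cc ^ i

/-- The endomorphism `ξ_m` of `F` with `ξ_m b = b_{-m+1}` and `ξ_m c = c²`. -/
def xi (m : ℤ) : FreeGroup (Fin 2) →* FreeGroup (Fin 2) :=
  FreeGroup.lift (fun x => if x = 0 then bseq (-m + 1) else cc ^ 2)

/-- The endomorphism `ξ'_m` of `F` with `ξ'_m b = b_{-m}` and `ξ'_m c = c²`. -/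
def xi' (m : ℤ) : FreeGroup (Fin 2) →* FreeGroup (Fin 2) :=
  FreeGroup.lift (fun x => if x = 0 then bseq (-m) else cc ^ 2)

section OneStep
open HNNExtension HNNExtension.NormalWord

variable {G : Type*} [Group G] {A B : Subgroup G} (φ : A ≃* B)

theorem hs_conj_mem (K : Subgroup G) (hK : ∀ a : A, (a : G) ∈ K ↔ (φ a : G) ∈ K)
    (u : ℤˣ) (g : G) (hgK : g ∈ K) (hg : g ∈ toSubgroup A B u) :
    ∃ g' ∈ K, (t ^ (u : ℤ) * of g : HNNExtension G A B φ) = of g' * t ^ (u : ℤ) := by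
  rcases Int.units_eq_one_or u with rfl | rfl
  · rw [toSubgroup_one] at hg
    refine ⟨φ ⟨g, hg⟩, (hK ⟨g, hg⟩).1 hgK, ?_⟩
    simpa using t_mul_of (φ := φ) ⟨g, hg⟩
  · rw [toSubgroup_neg_one] at hg
    refine ⟨φ.symm ⟨g, hg⟩, (hK _).2 (by simpa using hgK), ?_⟩
    simpa using inv_t_mul_of (φ := φ) ⟨g, hg⟩

theorem hs_good_mul_t (K : Subgroup G) (hK : ∀ a : A, (a : G) ∈ K ↔ (φ a : G) ∈ K)
    (u : ℤˣ) (g : G) (l : List (ℤˣ × G))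
    (hc : l.IsChain (fun a b => a.2 ∈ toSubgroup A B a.1 → a.1 = b.1))
    (hg : g ∈ K) (hl : ∀ p ∈ l, p.2 ∈ K) :
    ∃ w : ReducedWord G A B, w.prod φ =
      t ^ (u : ℤ) * (of g * (l.map (fun x => t ^ (x.1 : ℤ) * of x.2)).prod) ∧
      w.head ∈ K ∧ ∀ p ∈ w.toList, p.2 ∈ K := by
  by_cases h : (∃ p ∈ l.head?, g ∈ toSubgroup A B u ∧ p.1 ≠ u)
  · obtain ⟨p, hp, hgA, hne⟩ := h
    cases l with
    | nil => simp at hp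
    | cons q l =>
      simp only [List.head?_cons, Option.mem_def, Option.some.injEq] at hp
      subst hp
      obtain ⟨g', hg', he⟩ := hs_conj_mem φ K hK u g hg hgA
      have hu : (q.1 : ℤ) = -(u : ℤ) := by
        rcases Int.units_eq_one_or u with rfl | rfl <;>
        rcases Int.units_eq_one_or q.1 with h | h <;> simp_all
      refine ⟨⟨g' * q.2, l, hc.tail⟩, ?_, mul_mem hg' (hl q (by simp)), fun p hp => hl p (by simp [hp])⟩
      simp only [ReducedWord.prod, List.map_cons, List.prod_cons, map_mul]
      rw [← mul_assoc (t ^ (u : ℤ)), he, hu, zpow_neg]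
      group
  · refine ⟨⟨1, (u, g) :: l, ?_⟩, ?_, one_mem _, ?_⟩
    · rw [List.isChain_cons]
      refine ⟨fun p hp hgA => ?_, hc⟩
      by_contra hne
      exact h ⟨p, hp, hgA, fun h => hne h.symm⟩
    · simp [ReducedWord.prod, mul_assoc]
    · intro p hp
      rcases List.mem_cons.1 hp with rfl | hp
      · exact hg
      · exact hl p hp

theorem hs_onestep (K : Subgroup G) (hK : ∀ a : A, (a : G) ∈ K ↔ (φ a : G) ∈ K) (g : G)
    (hg : (of g : HNNExtension G A B φ) ∈ Subgroup.closure ((of '' (K : Set G)) ∪ {t})) :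
    g ∈ K := by
  have key : ∀ x ∈ Subgroup.closure ((of '' (K : Set G)) ∪ {t} : Set (HNNExtension G A B φ)),
      ∃ w : ReducedWord G A B, w.prod φ = x ∧ w.head ∈ K ∧ ∀ p ∈ w.toList, p.2 ∈ K := by
    intro x hx
    induction hx using Subgroup.closure_induction_left with
    | one => exact ⟨ReducedWord.empty G A B, by simp [ReducedWord.prod], by simp, by simp⟩
    | mul_left x hx y hy ih =>
      obtain ⟨⟨h, l, hc⟩, rfl, hh, hl⟩ := ih
      rcases hx with ⟨k, hk, rfl⟩ | rfl
      · exact ⟨⟨k * h, l, hc⟩, by simp [ReducedWord.prod, mul_assoc], mul_mem hk hh, hl⟩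
      · simpa [ReducedWord.prod] using hs_good_mul_t φ K hK 1 h l hc hh hl
    | inv_mul_cancel x hx y hy ih =>
      obtain ⟨⟨h, l, hc⟩, rfl, hh, hl⟩ := ih
      rcases hx with ⟨k, hk, rfl⟩ | rfl
      · exact ⟨⟨k⁻¹ * h, l, hc⟩, by simp [ReducedWord.prod, mul_assoc],
          mul_mem (inv_mem hk) hh, hl⟩
      · simpa [ReducedWord.prod] using hs_good_mul_t φ K hK (-1) h l hc hh hl
  obtain ⟨w, hw, hh, -⟩ := key _ hg
  have hn := ReducedWord.toList_eq_nil_of_mem_of_range φ w (by rw [hw]; exact ⟨g, rfl⟩)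
  rw [ReducedWord.prod, hn] at hw
  simp only [List.map_nil, List.prod_nil, mul_one] at hw
  rwa [← of_injective φ hw]

/-- The isomorphism between the ranges of two injective homs. -/
noncomputable def hsEquiv {X : Type*} [Group X] (α β : X →* G) (hα : Function.Injective α)
    (hβ : Function.Injective β) : α.range ≃* β.range :=
  (MonoidHom.ofInjective hα).symm.trans (MonoidHom.ofInjective hβ)

theorem hsEquiv_apply {X : Type*} [Group X] (α β : X →* G) (hα : Function.Injective α)
    (hβ : Function.Injective β) (x : X) :
    hsEquiv α β hα hβ ⟨α x, x, rfl⟩ = ⟨β x, x, rfl⟩ := by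
  have : (MonoidHom.ofInjective hα).symm ⟨α x, x, rfl⟩ = x := by
    rw [MulEquiv.symm_apply_eq]; rfl
  simp only [hsEquiv, MulEquiv.trans_apply, this]
  rfl

end OneStep

/-- The inclusion direction for a general double HNN extension. -/
theorem hs_double {F : Type} [Group F] (f g : F →* F) (hf : Function.Injective f)
    (hg : Function.Injective g) (H : Subgroup F) (hfH : ∀ x, x ∈ H ↔ f x ∈ H)
    (hgH : ∀ x, x ∈ H ↔ g x ∈ H) (S : Set F) (hS : S ⊆ H) (x : F)
    (hx : HNN2.of f g x ∈ Subgroup.closure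
      ((HNN2.of f g '' S) ∪ {HNN2.t₁ f g, HNN2.t₂ f g})) : x ∈ H := by
  let e₁ := hsEquiv (MonoidHom.id F) f Function.injective_id hf
  let G₁ := HNNExtension F _ _ e₁
  let o₁ : F →* G₁ := HNNExtension.of
  have ho₁ : Function.Injective o₁ := HNNExtension.of_injective e₁
  let e₂ := hsEquiv o₁ (o₁.comp g) ho₁ (ho₁.comp hg)
  let G₂ := HNNExtension G₁ _ _ e₂
  let o₂ : G₁ →* G₂ := HNNExtension.of
  let K : Subgroup G₁ := Subgroup.closure ((o₁ '' (H : Set F)) ∪ {HNNExtension.t})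
  let L : Subgroup G₂ := Subgroup.closure ((o₂ '' (K : Set G₁)) ∪ {HNNExtension.t})
  have hK : ∀ y, o₁ y ∈ K ↔ y ∈ H := by
    refine fun y => ⟨fun h => ?_, fun h => Subgroup.subset_closure (Or.inl ⟨y, h, rfl⟩)⟩
    refine hs_onestep e₁ H ?_ y h
    rintro ⟨_, a, rfl⟩
    rw [hsEquiv_apply]
    exact hfH a
  have hL : ∀ y, o₂ y ∈ L → y ∈ K := by
    refine fun y h => hs_onestep e₂ K ?_ y h
    rintro ⟨_, a, rfl⟩
    rw [hsEquiv_apply]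
    change o₁ a ∈ K ↔ o₁ (g a) ∈ K
    rw [hK, hK]
    exact hgH a
  let T₁ : G₂ := (o₂ HNNExtension.t)⁻¹
  let T₂ : G₂ := (HNNExtension.t)⁻¹
  have r₁ : ∀ a, T₁⁻¹ * o₂ (o₁ a) * T₁ = o₂ (o₁ (f a)) := by
    intro a
    have h := HNNExtension.equiv_eq_conj (φ := e₁) ⟨a, a, rfl⟩
    have h2 : e₁ ⟨a, a, rfl⟩ = ⟨f a, a, rfl⟩ := hsEquiv_apply _ _ _ _ a
    rw [h2] at h
    have h3 := congrArg o₂ h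
    rw [map_mul, map_mul, map_inv] at h3
    simp only [T₁, inv_inv]
    exact h3.symm
  have r₂ : ∀ a, T₂⁻¹ * o₂ (o₁ a) * T₂ = o₂ (o₁ (g a)) := by
    intro a
    have h := HNNExtension.equiv_eq_conj (φ := e₂) ⟨o₁ a, a, rfl⟩
    have h2 : e₂ ⟨o₁ a, a, rfl⟩ = ⟨o₁ (g a), a, rfl⟩ := hsEquiv_apply _ _ _ _ a
    rw [h2] at h
    simp only [T₂, inv_inv]
    exact h.symm
  let p : Coprod F (FreeGroup Bool) →* G₂ :=
    Coprod.lift (o₂.comp o₁) (FreeGroup.lift (fun b => if b then T₂ else T₁))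
  let P : HNN2 f g →* G₂ := QuotientGroup.lift _ p (by
    intro y hy
    have hle : Subgroup.normalClosure
        {x : Coprod F (FreeGroup Bool) |
      (∃ a : F, x = (Coprod.inr (FreeGroup.of false))⁻¹ * Coprod.inl a *
        Coprod.inr (FreeGroup.of false) * (Coprod.inl (f a))⁻¹) ∨
      (∃ a : F, x = (Coprod.inr (FreeGroup.of true))⁻¹ * Coprod.inl a *
        Coprod.inr (FreeGroup.of true) * (Coprod.inl (g a))⁻¹)} ≤ p.ker := by
      apply Subgroup.normalClosure_le_normal
      rintro _ (⟨a, rfl⟩ | ⟨a, rfl⟩)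
      · simp only [SetLike.mem_coe, MonoidHom.mem_ker, map_mul, map_inv, p, Coprod.lift_apply_inl,
          Coprod.lift_apply_inr, FreeGroup.lift_apply_of, MonoidHom.comp_apply, ← r₁]
        simp
      · simp only [SetLike.mem_coe, MonoidHom.mem_ker, map_mul, map_inv, p, Coprod.lift_apply_inl,
          Coprod.lift_apply_inr, FreeGroup.lift_apply_of, MonoidHom.comp_apply, ← r₂]
        simp
    exact hle hy)
  have Po : ∀ a, P (HNN2.of f g a) = o₂ (o₁ a) := fun a => by
    change p (Coprod.inl a) = _
    simp [p]
  have P₁ : P (HNN2.t₁ f g) = T₁ := by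
    change p (Coprod.inr (FreeGroup.of false)) = _
    simp [p]
  have P₂ : P (HNN2.t₂ f g) = T₂ := by
    change p (Coprod.inr (FreeGroup.of true)) = _
    simp [p]
  have hle : Subgroup.closure
      ((HNN2.of f g '' S) ∪ {HNN2.t₁ f g, HNN2.t₂ f g}) ≤ L.comap P := by
    rw [Subgroup.closure_le]
    rintro _ (⟨s, hs, rfl⟩ | rfl | rfl)
    · change P _ ∈ L
      rw [Po]
      exact Subgroup.subset_closure (Or.inl ⟨_, (hK s).2 (hS hs), rfl⟩)
    · change P _ ∈ L
      rw [P₁]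
      exact inv_mem (Subgroup.subset_closure (Or.inl ⟨_, Subgroup.subset_closure (Or.inr rfl), rfl⟩))
    · change P _ ∈ L
      rw [P₂]
      exact inv_mem (Subgroup.subset_closure (Or.inr rfl))
  have h1 : P (HNN2.of f g x) ∈ L := hle hx
  rw [Po] at h1
  exact (hK x).1 (hL _ h1)

theorem hs_rel₁ {F : Type} [Group F] (f g : F →* F) (a : F) :
    (HNN2.t₁ f g)⁻¹ * HNN2.of f g a * HNN2.t₁ f g = HNN2.of f g (f a) := by
  rw [← mul_inv_eq_one]
  exact (QuotientGroup.eq_one_iff _).2 (Subgroup.subset_normalClosure (Or.inl ⟨a, rfl⟩))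

theorem hs_rel₂ {F : Type} [Group F] (f g : F →* F) (a : F) :
    (HNN2.t₂ f g)⁻¹ * HNN2.of f g a * HNN2.t₂ f g = HNN2.of f g (g a) := by
  rw [← mul_inv_eq_one]
  exact (QuotientGroup.eq_one_iff _).2 (Subgroup.subset_normalClosure (Or.inr ⟨a, rfl⟩))

/-- Shift action of `ℤ` on the free group on `ℤ`. -/
def hsShift : Multiplicative ℤ →* MulAut (FreeGroup ℤ) where
  toFun n := FreeGroup.freeGroupCongr (Equiv.subRight n.toAdd)
  map_one' := by
    apply MulEquiv.toMonoidHom_injective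
    ext i
    simp
  map_mul' a b := by
    apply MulEquiv.toMonoidHom_injective
    ext i
    simp [sub_sub, add_comm]

theorem hsShift_of (n : Multiplicative ℤ) (i : ℤ) :
    hsShift n (FreeGroup.of i) = FreeGroup.of (i - n.toAdd) := by
  simp [hsShift]

/-- The free group on the `b_i`. -/
def hsIota : FreeGroup ℤ →* FreeGroup (Fin 2) := FreeGroup.lift bseq

/-- The map to the semidirect product. -/
def hsPi : FreeGroup (Fin 2) →* FreeGroup ℤ ⋊[hsShift] Multiplicative ℤ :=
  FreeGroup.lift (fun x => if x = 0 then SemidirectProduct.inl (FreeGroup.of 0)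
    else SemidirectProduct.inr (Multiplicative.ofAdd 1))

theorem hsPi_bseq (i : ℤ) : hsPi (bseq i) = SemidirectProduct.inl (FreeGroup.of i) := by
  have hb : hsPi bb = SemidirectProduct.inl (FreeGroup.of 0) := by simp [hsPi, bb]
  have hc : hsPi cc = SemidirectProduct.inr (Multiplicative.ofAdd 1) := by simp [hsPi, cc]
  have h := SemidirectProduct.inl_aut (φ := hsShift) (Multiplicative.ofAdd (1 : ℤ) ^ (-i))
    (FreeGroup.of 0)
  rw [hsShift_of] at h
  simp only [bseq, map_mul, map_zpow, hb, hc]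
  simpa using h.symm

theorem hsPi_iota (v : FreeGroup ℤ) : hsPi (hsIota v) = SemidirectProduct.inl v := by
  have : hsPi.comp hsIota = SemidirectProduct.inl := by
    ext1 i
    simp [hsIota, hsPi_bseq]
  exact DFunLike.congr_fun this v

theorem cc_conj_bseq (i n : ℤ) : cc ^ n * bseq i * (cc ^ n)⁻¹ = bseq (i - n) := by
  simp only [bseq]; group

/-- Inverse of `hsPi`. -/
def hsQ : FreeGroup ℤ ⋊[hsShift] Multiplicative ℤ →* FreeGroup (Fin 2) :=
  SemidirectProduct.lift hsIota (zpowersHom _ cc) (by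
    intro n
    ext1 i
    simp only [MonoidHom.comp_apply, MulEquiv.coe_toMonoidHom, hsShift_of, hsIota,
      FreeGroup.lift_apply_of, ← cc_conj_bseq, zpowersHom_apply, MulAut.conj_apply])

theorem hs_decomp (w : FreeGroup (Fin 2)) :
    w = hsIota (hsPi w).left * cc ^ (hsPi w).right.toAdd := by
  have h : hsQ.comp hsPi = MonoidHom.id _ := by
    ext1 i
    fin_cases i
    · simp [hsPi, hsQ, hsIota, bseq, bb]
    · simp [hsPi, hsQ, hsIota, bseq, cc]
  exact (DFunLike.congr_fun h w).symm

theorem hs_free (f : FreeGroup (Fin 2) →* FreeGroup (Fin 2)) (k : ℤ) (hb : f bb = bseq k)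
    (hc : f cc = cc ^ 2) (S : Set ℤ) (hS : ∀ i, i ∈ S ↔ 2 * i + k ∈ S) (w : FreeGroup (Fin 2)) :
    w ∈ Subgroup.closure {x | ∃ i : ℤ, i ∈ S ∧ x = bseq i} ↔
    f w ∈ Subgroup.closure {x | ∃ i : ℤ, i ∈ S ∧ x = bseq i} := by
  have hfi : ∀ i, f (bseq i) = bseq (2 * i + k) := by
    intro i
    have hc2 : f cc = cc ^ (2 : ℤ) := by rw [hc]; norm_cast
    simp only [bseq, map_mul, map_zpow, hb, hc2]
    simp only [← zpow_mul]
    group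
  constructor
  · intro hw
    have : Subgroup.closure {x | ∃ i : ℤ, i ∈ S ∧ x = bseq i} ≤
        (Subgroup.closure {x | ∃ i : ℤ, i ∈ S ∧ x = bseq i}).comap f := by
      rw [Subgroup.closure_le]
      rintro _ ⟨i, hi, rfl⟩
      change f (bseq i) ∈ Subgroup.closure _
      rw [hfi]
      exact Subgroup.subset_closure ⟨_, (hS i).1 hi, rfl⟩
    exact this hw
  · intro hw
    let M : Subgroup (FreeGroup ℤ) := Subgroup.closure (FreeGroup.of '' S)
    have hmap : M.map hsIota = Subgroup.closure {x | ∃ i : ℤ, i ∈ S ∧ x = bseq i} := by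
      rw [MonoidHom.map_closure]
      congr 1
      ext x
      simp [hsIota, eq_comm]
    rw [← hmap] at hw ⊢
    obtain ⟨u, hu, huw⟩ := hw
    let d : FreeGroup ℤ →* FreeGroup ℤ := FreeGroup.lift (fun i => FreeGroup.of (2 * i + k))
    have hd : ∀ v, f (hsIota v) = hsIota (d v) := by
      intro v
      have : f.comp hsIota = hsIota.comp d := by
        ext1 i
        simp [hsIota, d, hfi]
      exact DFunLike.congr_fun this v
    set v := (hsPi w).left
    set n := (hsPi w).right.toAdd
    have hdec : w = hsIota v * cc ^ n := hs_decomp w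
    have hfw : f w = hsIota (d v) * cc ^ (2 * n) := by
      rw [hdec, map_mul, hd, map_zpow, hc, zpow_mul]; norm_cast
    have hpc : hsPi cc = SemidirectProduct.inr (Multiplicative.ofAdd 1) := by simp [hsPi, cc]
    have hpz : ∀ z : ℤ, hsPi (cc ^ z) = SemidirectProduct.inr (Multiplicative.ofAdd z) := by
      intro z
      rw [map_zpow, hpc]
      have := (map_zpow (SemidirectProduct.inr (φ := hsShift)) (Multiplicative.ofAdd 1) z).symm
      rw [this]
      congr 1
      rw [← ofAdd_zsmul]
      simp
    have h1 : hsPi (hsIota u) = hsPi (hsIota (d v) * cc ^ (2 * n)) := by rw [huw, hfw]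
    rw [map_mul, hsPi_iota, hsPi_iota, hpz] at h1
    have hl := congrArg SemidirectProduct.left h1
    have hr := congrArg SemidirectProduct.right h1
    simp only [SemidirectProduct.left_inl, SemidirectProduct.mul_left,
      SemidirectProduct.left_inr, map_one, mul_one] at hl
    have hn : n = 0 := by
      have := congrArg Multiplicative.toAdd hr
      simp only [SemidirectProduct.right_inl, SemidirectProduct.mul_right,
        SemidirectProduct.right_inr, one_mul, toAdd_one, toAdd_ofAdd] at this
      omega
    classical
    let e : FreeGroup ℤ →* FreeGroup ℤ :=
      FreeGroup.lift (fun j => if 2 * ((j - k) / 2) + k = j then FreeGroup.of ((j - k) / 2) else 1)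
    have hed : ∀ x, e (d x) = x := by
      intro x
      have : e.comp d = MonoidHom.id _ := by
        ext1 i
        simp [e, d]
      exact DFunLike.congr_fun this x
    have heM : M ≤ M.comap e := by
      rw [Subgroup.closure_le]
      rintro _ ⟨j, hj, rfl⟩
      change e _ ∈ M
      simp only [e, FreeGroup.lift_apply_of]
      split_ifs with h
      · refine Subgroup.subset_closure ⟨_, (hS _).2 ?_, rfl⟩
        rwa [h]
      · exact one_mem _
    refine ⟨v, ?_, by rw [hdec, hn]; simp⟩
    have := heM hu
    rw [hl] at this
    change e (d v) ∈ M at this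
    rwa [hed] at this

theorem hs_xi_b (m : ℤ) : xi m bb = bseq (-m + 1) := by simp [xi, bb]
theorem hs_xi_c (m : ℤ) : xi m cc = cc ^ 2 := by simp [xi, cc]
theorem hs_xi'_b (m : ℤ) : xi' m bb = bseq (-m) := by simp [xi', bb]
theorem hs_xi'_c (m : ℤ) : xi' m cc = cc ^ 2 := by simp [xi', cc]

theorem hs_image (f : FreeGroup (Fin 2) →* FreeGroup (Fin 2)) (k : ℤ) (hb : f bb = bseq k)
    (hc : f cc = cc ^ 2) (i : ℤ) : f (bseq i) = bseq (2 * i + k) := by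
  have hc2 : f cc = cc ^ (2 : ℤ) := by rw [hc]; norm_cast
  simp only [bseq, map_mul, map_zpow, hb, hc2]
  simp only [← zpow_mul]
  group

theorem hs_main (m : ℤ)
    (hxi : Function.Injective (xi m)) (hxi' : Function.Injective (xi' m)) (S : Set ℤ) (s : ℤ)
    (hs : s ∈ S) (h1 : ∀ i, i ∈ S ↔ 2 * i + (-m + 1) ∈ S) (h2 : ∀ i, i ∈ S ↔ 2 * i + (-m) ∈ S)
    (hgen : ∀ D : Set ℤ, s ∈ D → (∀ i ∈ D, 2 * i + (-m + 1) ∈ D) → (∀ i ∈ D, 2 * i + (-m) ∈ D) →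
      S ⊆ D) :
    (HNN2.of (xi m) (xi' m)).range ⊓
        Subgroup.closure {HNN2.of (xi m) (xi' m) (bseq s), HNN2.t₁ (xi m) (xi' m),
          HNN2.t₂ (xi m) (xi' m)} =
      Subgroup.map (HNN2.of (xi m) (xi' m))
        (Subgroup.closure {x | ∃ i : ℤ, i ∈ S ∧ x = bseq i}) := by
  set C := Subgroup.closure {HNN2.of (xi m) (xi' m) (bseq s), HNN2.t₁ (xi m) (xi' m),
          HNN2.t₂ (xi m) (xi' m)} with hC
  have ht₁ : HNN2.t₁ (xi m) (xi' m) ∈ C := Subgroup.subset_closure (by simp)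
  have ht₂ : HNN2.t₂ (xi m) (xi' m) ∈ C := Subgroup.subset_closure (by simp)
  apply le_antisymm
  · rintro _ ⟨⟨x, rfl⟩, hx⟩
    refine ⟨x, ?_, rfl⟩
    refine hs_double (xi m) (xi' m) hxi hxi' _
      (hs_free _ _ (hs_xi_b m) (hs_xi_c m) S h1) (hs_free _ _ (hs_xi'_b m) (hs_xi'_c m) S h2)
      {bseq s} ?_ x ?_
    · rintro _ rfl
      exact Subgroup.subset_closure ⟨s, hs, rfl⟩
    · rw [Set.image_singleton]
      exact hx
  · refine le_inf (fun y ⟨x, _, hx⟩ => ⟨x, hx⟩) ?_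
    rw [Subgroup.map_le_iff_le_comap, Subgroup.closure_le]
    rintro _ ⟨i, hi, rfl⟩
    refine hgen {i | HNN2.of (xi m) (xi' m) (bseq i) ∈ C} ?_ ?_ ?_ hi
    · exact Subgroup.subset_closure (by simp)
    · intro i hi
      change _ ∈ C
      rw [← hs_image _ _ (hs_xi_b m) (hs_xi_c m), ← hs_rel₁]
      exact mul_mem (mul_mem (inv_mem ht₁) hi) ht₁
    · intro i hi
      change _ ∈ C
      rw [← hs_image _ _ (hs_xi'_b m) (hs_xi'_c m), ← hs_rel₂]
      exact mul_mem (mul_mem (inv_mem ht₂) hi) ht₂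

theorem stmt16 (m : ℤ)
    (hxi : Function.Injective (xi m)) (hxi' : Function.Injective (xi' m)) :
    -- in `Ξ_m = F *_{ξ_m, ξ'_m}(t_m, t'_m)`:
    -- `F ∩ ⟨b_m, t_m, t'_m⟩ = ⟨b_m, b_{m+1}, b_{m+2}, …⟩`
    (HNN2.of (xi m) (xi' m)).range ⊓
        Subgroup.closure {HNN2.of (xi m) (xi' m) (bseq m), HNN2.t₁ (xi m) (xi' m),
          HNN2.t₂ (xi m) (xi' m)} =
      Subgroup.map (HNN2.of (xi m) (xi' m))
        (Subgroup.closure {x | ∃ i : ℤ, m ≤ i ∧ x = bseq i}) ∧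
    -- `F ∩ ⟨b_{m-1}, t_m, t'_m⟩ = ⟨b_{m-1}, b_{m-2}, b_{m-3}, …⟩`
    (HNN2.of (xi m) (xi' m)).range ⊓
        Subgroup.closure {HNN2.of (xi m) (xi' m) (bseq (m - 1)), HNN2.t₁ (xi m) (xi' m),
          HNN2.t₂ (xi m) (xi' m)} =
      Subgroup.map (HNN2.of (xi m) (xi' m))
        (Subgroup.closure {x | ∃ i : ℤ, i ≤ m - 1 ∧ x = bseq i}) := by
  constructor
  · refine hs_main m hxi hxi' {i | m ≤ i} m (le_refl m) ?_ ?_ ?_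
    · intro i; simp only [Set.mem_ofPred_eq]; omega
    · intro i; simp only [Set.mem_ofPred_eq]; omega
    · intro D hD hD1 hD2
      have key : ∀ n : ℕ, m + n ∈ D := by
        intro n
        induction n using Nat.strong_induction_on with
        | _ n ih =>
          by_cases h0 : n = 0
          · subst h0; simpa using hD
          rcases Nat.even_or_odd' n with ⟨j, rfl | rfl⟩
          · have := hD2 _ (ih j (by omega))
            convert this using 1
            push_cast; ring
          · have := hD1 _ (ih j (by omega))
            convert this using 1
            push_cast; ring
      intro i hi
      have := key (i - m).toNat
      rwa [Int.toNat_of_nonneg (sub_nonneg.2 hi), add_sub_cancel] at this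
  · refine hs_main m hxi hxi' {i | i ≤ m - 1} (m - 1) (le_refl (m - 1)) ?_ ?_ ?_
    · intro i; simp only [Set.mem_ofPred_eq]; omega
    · intro i; simp only [Set.mem_ofPred_eq]; omega
    · intro D hD hD1 hD2
      have key : ∀ n : ℕ, m - 1 - n ∈ D := by
        intro n
        induction n using Nat.strong_induction_on with
        | _ n ih =>
          by_cases h0 : n = 0
          · subst h0; simpa using hD
          rcases Nat.even_or_odd' n with ⟨j, rfl | rfl⟩
          · have := hD1 _ (ih j (by omega))
            convert this using 1
            push_cast; ring
          · have := hD2 _ (ih j (by omega))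
            convert this using 1
            push_cast; ring
      intro i hi
      have := key (m - 1 - i).toNat
      rwa [Int.toNat_of_nonneg (sub_nonneg.2 hi), sub_sub_cancel] at this
end

section
/- Let F = ⟨b, c⟩ be the free group of rank 2, b_i = c^{-i} b c^{i} for i ∈ ℤ, and for fixed m ∈ ℤ let Ξ_m = F *_{ξ_m, ξ'_m}(t_m, t'_m) be the HNN extension of F by two stable letters with respect to the injective endomorphisms ξ_m, ξ'_m of F given by ξ_m(b) = b_{-m+1}, ξ'_m(b) = b_{-m}, ξ_m(c) = ξ'_m(c) = c². Let Θ = ⟨a⟩ * Ξ_m be the free product of an infinite cyclic group ⟨a⟩ with Ξ_m, and let G = ⟨a, b, c⟩ be the subgroup of Θ generated by a, b, c (a free group of rank 3). Then in Θ: G ∩ ⟨b_m, t_m, t'_m⟩ = ⟨b_m, b_{m+1}, …⟩; G ∩ ⟨a, b_m, t_m, t'_m⟩ = ⟨a, b_m, b_{m+1}, …⟩; G ∩ ⟨b_{m-1}, t_m, t'_m⟩ = ⟨b_{m-1}, b_{m-2}, …⟩; and G ∩ ⟨a, b_{m-1}, t_m, t'_m⟩ = ⟨a, b_{m-1}, b_{m-2},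 …⟩, where ⟨b_m, b_{m+1}, …⟩ denotes the subgroup generated by all b_i with i ≥ m and ⟨b_{m-1}, b_{m-2}, …⟩ the subgroup generated by all b_i with i ≤ m−1. -/
open Monoid

namespace Stmt17

/-- Index set: the left summand indexes conjugates of `b`, the right one conjugates of `a`. -/
abbrev P := (ℤ × ℤ) ⊕ (ℤ × ℤ)

/-- The action of a permutation of `P` on the free group on `P`. -/
def act : Equiv.Perm P →* MulAut (FreeGroup P) where
  toFun e := FreeGroup.freeGroupCongr e
  map_one' := by
    ext x
    simp
  map_mul' e f := by
    ext x
    simp [FreeGroup.map.comp]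

@[simp] lemma act_of (e : Equiv.Perm P) (p : P) :
    act e (FreeGroup.of p) = FreeGroup.of (e p) := by
  simp [act]

/-- The target group. -/
abbrev W := FreeGroup P ⋊[act] Equiv.Perm P

/-- `(x, j) ↦ (2 x - m + 1 - j % 2, j / 2)`. -/
def L1 (m : ℤ) : Equiv.Perm (ℤ × ℤ) where
  toFun p := (2 * p.1 - m + 1 - p.2 % 2, p.2 / 2)
  invFun p := ((p.1 + m) / 2, 2 * p.2 + (1 - (p.1 + m) % 2))
  left_inv p := by
    ext <;> simp <;> omega
  right_inv p := by
    ext <;> simp <;> omega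

/-- `(x, j) ↦ (2 x - m + j % 2, j / 2)`. -/
def L2 (m : ℤ) : Equiv.Perm (ℤ × ℤ) where
  toFun p := (2 * p.1 - m + p.2 % 2, p.2 / 2)
  invFun p := ((p.1 + m) / 2, 2 * p.2 + (p.1 + m) % 2)
  left_inv p := by
    ext <;> simp <;> omega
  right_inv p := by
    ext <;> simp <;> omega

/-- Inverse shift. -/
def C0 : Equiv.Perm (ℤ × ℤ) where
  toFun p := (p.1 - 1, p.2)
  invFun p := (p.1 + 1, p.2)
  left_inv p := by simp
  right_inv p := by simp

def C : Equiv.Perm P := Equiv.sumCongr C0 C0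
def U1 (m : ℤ) : Equiv.Perm P := Equiv.sumCongr (L1 m) (L2 0)
def U2 (m : ℤ) : Equiv.Perm P := Equiv.sumCongr (L2 m) (L2 0)

@[simp] lemma C_inl (x j : ℤ) : C (Sum.inl (x, j)) = Sum.inl (x - 1, j) := rfl
@[simp] lemma C_inr (x j : ℤ) : C (Sum.inr (x, j)) = Sum.inr (x - 1, j) := rfl
@[simp] lemma U1_inl (m x j : ℤ) :
    U1 m (Sum.inl (x, j)) = Sum.inl (2 * x - m + 1 - j % 2, j / 2) := rfl
@[simp] lemma U1_inr (m x j : ℤ) :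
    U1 m (Sum.inr (x, j)) = Sum.inr (2 * x - 0 + j % 2, j / 2) := rfl
@[simp] lemma U2_inl (m x j : ℤ) :
    U2 m (Sum.inl (x, j)) = Sum.inl (2 * x - m + j % 2, j / 2) := rfl
@[simp] lemma U2_inr (m x j : ℤ) :
    U2 m (Sum.inr (x, j)) = Sum.inr (2 * x - 0 + j % 2, j / 2) := rfl

lemma Cpow (k : ℤ) : ∀ x j : ℤ, (C ^ k) (Sum.inl (x, j)) = Sum.inl (x - k, j) ∧
    (C ^ k) (Sum.inr (x, j)) = Sum.inr (x - k, j) := by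
  induction k using Int.induction_on with
  | zero => intro x j; simp
  | succ n ih =>
    intro x j
    rw [zpow_add_one, Equiv.Perm.mul_apply, Equiv.Perm.mul_apply, C_inl, C_inr,
      (ih _ _).1, (ih _ _).2]
    constructor <;> congr 2 <;> ring
  | pred n ih =>
    intro x j
    have h1 : C⁻¹ (Sum.inl (x, j)) = Sum.inl (x + 1, j) := rfl
    have h2 : C⁻¹ (Sum.inr (x, j)) = Sum.inr (x + 1, j) := rfl
    rw [zpow_sub_one, Equiv.Perm.mul_apply, Equiv.Perm.mul_apply, h1, h2,
      (ih _ _).1, (ih _ _).2]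
    constructor <;> congr 2 <;> ring

lemma U1C (m : ℤ) : U1 m * C = C ^ 2 * U1 m := by
  ext p
  rcases p with ⟨x, j⟩ | ⟨x, j⟩
  · simp only [pow_two, Equiv.Perm.mul_apply, C_inl, U1_inl]
    congr 2; ring
  · simp only [pow_two, Equiv.Perm.mul_apply, C_inr, U1_inr]
    congr 2; ring

lemma U2C (m : ℤ) : U2 m * C = C ^ 2 * U2 m := by
  ext p
  rcases p with ⟨x, j⟩ | ⟨x, j⟩
  · simp only [pow_two, Equiv.Perm.mul_apply, C_inl, U2_inl]
    congr 2; ring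
  · simp only [pow_two, Equiv.Perm.mul_apply, C_inr, U2_inr]
    congr 2; ring

/-- conjugation in `W` -/
lemma conjW (e : Equiv.Perm P) (p : P) :
    (SemidirectProduct.inr e : W) * SemidirectProduct.inl (FreeGroup.of p) *
      (SemidirectProduct.inr e)⁻¹ = SemidirectProduct.inl (FreeGroup.of (e p)) := by
  rw [← act_of, SemidirectProduct.inl_aut, map_inv]

/-- The homomorphism on `F`. -/
def fF : FreeGroup (Fin 2) →* W :=
  FreeGroup.lift (fun x => if x = 0 then SemidirectProduct.inl (FreeGroup.of (Sum.inl (0, 0)))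
    else SemidirectProduct.inr C)

lemma fF_bb : fF bb = SemidirectProduct.inl (FreeGroup.of (Sum.inl (0, 0))) := by
  simp [fF, bb]

lemma fF_cc : fF cc = SemidirectProduct.inr C := by
  simp [fF, cc]

lemma fF_bseq (i : ℤ) :
    fF (bseq i) = SemidirectProduct.inl (FreeGroup.of (Sum.inl (i, 0))) := by
  have h := conjW (C ^ (-i)) (Sum.inl (0, 0))
  rw [(Cpow _ _ _).1] at h
  rw [bseq, map_mul, map_mul, fF_bb, map_zpow, map_zpow, fF_cc]
  simpa using h

lemma xi_bb (m : ℤ) : xi m bb = bseq (-m + 1) := by simp [xi, bb]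
lemma xi_cc (m : ℤ) : xi m cc = cc ^ 2 := by simp [xi, cc]
lemma xi'_bb (m : ℤ) : xi' m bb = bseq (-m) := by simp [xi', bb]
lemma xi'_cc (m : ℤ) : xi' m cc = cc ^ 2 := by simp [xi', cc]

lemma homF_ext {H : Type} [Group H] {f g : FreeGroup (Fin 2) →* H}
    (hb : f bb = g bb) (hc : f cc = g cc) : f = g := by
  ext x
  fin_cases x
  · exact hb
  · exact hc

lemma rel1 (m : ℤ) (x : FreeGroup (Fin 2)) :
    (SemidirectProduct.inr (U1 m) : W) * fF x * (SemidirectProduct.inr (U1 m))⁻¹ =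
      fF (xi m x) := by
  have : (MulAut.conj (SemidirectProduct.inr (U1 m) : W)).toMonoidHom.comp fF =
      fF.comp (xi m) := by
    apply homF_ext
    · simp only [MonoidHom.comp_apply, xi_bb, fF_bseq, fF_bb]
      simp only [MulEquiv.coe_toMonoidHom, MulAut.conj_apply, conjW, U1_inl]
      congr 3; simp
    · simp only [MonoidHom.comp_apply, xi_cc, map_pow, fF_cc]
      simp only [MulEquiv.coe_toMonoidHom, MulAut.conj_apply]
      rw [mul_inv_eq_iff_eq_mul, ← map_mul, U1C, map_mul, map_pow]
  exact DFunLike.congr_fun this x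

lemma rel2 (m : ℤ) (x : FreeGroup (Fin 2)) :
    (SemidirectProduct.inr (U2 m) : W) * fF x * (SemidirectProduct.inr (U2 m))⁻¹ =
      fF (xi' m x) := by
  have : (MulAut.conj (SemidirectProduct.inr (U2 m) : W)).toMonoidHom.comp fF =
      fF.comp (xi' m) := by
    apply homF_ext
    · simp only [MonoidHom.comp_apply, xi'_bb, fF_bseq, fF_bb]
      simp only [MulEquiv.coe_toMonoidHom, MulAut.conj_apply, conjW, U2_inl]
      congr 3; simp
    · simp only [MonoidHom.comp_apply, xi'_cc, map_pow, fF_cc]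
      simp only [MulEquiv.coe_toMonoidHom, MulAut.conj_apply]
      rw [mul_inv_eq_iff_eq_mul, ← map_mul, U2C, map_mul, map_pow]
  exact DFunLike.congr_fun this x

/-- The homomorphism on the HNN extension. -/
def fX (m : ℤ) : HNN2 (xi m) (xi' m) →* W :=
  QuotientGroup.lift _ (Coprod.lift fF (FreeGroup.lift (fun s : Bool =>
    (SemidirectProduct.inr (if s then U2 m else U1 m) : W)⁻¹))) (by
      intro x hx
      have hle := Subgroup.normalClosure_le_normal (N := (Coprod.lift fF
        (FreeGroup.lift (fun s : Bool =>
          (SemidirectProduct.inr (if s then U2 m else U1 m) : W)⁻¹))).ker) (s := _) (by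
        rintro y (⟨a, rfl⟩ | ⟨a, rfl⟩)
        · have := rel1 m a
          simp [MonoidHom.mem_ker, ← this]
        · have := rel2 m a
          simp [MonoidHom.mem_ker, ← this]) hx
      exact hle)

abbrev Th (m : ℤ) := Coprod (FreeGroup Unit) (HNN2 (xi m) (xi' m))

/-- The homomorphism on `Θ`. -/
def fT (m : ℤ) : Th m →* W :=
  Coprod.lift (FreeGroup.lift (fun _ =>
    SemidirectProduct.inl (FreeGroup.of (Sum.inr (0, 0))))) (fX m)

def eF (m : ℤ) : FreeGroup (Fin 2) →* Th m := Coprod.inr.comp (HNN2.of (xi m) (xi' m))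
def aT (m : ℤ) : Th m := Coprod.inl (FreeGroup.of ())
def T1 (m : ℤ) : Th m := Coprod.inr (HNN2.t₁ (xi m) (xi' m))
def T2 (m : ℤ) : Th m := Coprod.inr (HNN2.t₂ (xi m) (xi' m))

lemma fT_a (m : ℤ) : fT m (aT m) = SemidirectProduct.inl (FreeGroup.of (Sum.inr (0, 0))) := by
  simp [fT, aT]

lemma fT_e (m : ℤ) (x : FreeGroup (Fin 2)) : fT m (eF m x) = fF x := by
  simp only [fT, eF, MonoidHom.comp_apply, Coprod.lift_apply_inr]
  simp [fX, HNN2.of]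

lemma fT_1 (m : ℤ) : fT m (T1 m) = (SemidirectProduct.inr (U1 m))⁻¹ := by
  simp only [fT, T1, Coprod.lift_apply_inr]
  simp [fX, HNN2.t₁]

lemma fT_2 (m : ℤ) : fT m (T2 m) = (SemidirectProduct.inr (U2 m))⁻¹ := by
  simp only [fT, T2, Coprod.lift_apply_inr]
  simp [fX, HNN2.t₂]

lemma T1_conj (m : ℤ) (x : FreeGroup (Fin 2)) :
    (T1 m)⁻¹ * eF m x * T1 m = eF m (xi m x) := by
  simp only [T1, eF, MonoidHom.comp_apply, ← map_mul, ← map_inv]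
  congr 1
  rw [← mul_inv_eq_one]
  simp only [HNN2.t₁, HNN2.of, MonoidHom.comp_apply, ← map_mul, ← map_inv]
  rw [QuotientGroup.mk'_apply, QuotientGroup.eq_one_iff]
  exact Subgroup.subset_normalClosure (Or.inl ⟨x, by simp⟩)

lemma T2_conj (m : ℤ) (x : FreeGroup (Fin 2)) :
    (T2 m)⁻¹ * eF m x * T2 m = eF m (xi' m x) := by
  simp only [T2, eF, MonoidHom.comp_apply, ← map_mul, ← map_inv]
  congr 1
  rw [← mul_inv_eq_one]
  simp only [HNN2.t₂, HNN2.of, MonoidHom.comp_apply, ← map_mul, ← map_inv]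
  rw [QuotientGroup.mk'_apply, QuotientGroup.eq_one_iff]
  exact Subgroup.subset_normalClosure (Or.inr ⟨x, by simp⟩)

lemma xi_bseq (m i : ℤ) : xi m (bseq i) = bseq (2 * i - m + 1) := by
  rw [bseq, map_mul, map_mul, map_zpow, map_zpow, xi_bb, xi_cc, bseq, bseq]
  simp only [← zpow_natCast, ← zpow_mul, mul_assoc, ← zpow_add]
  simp only [← mul_assoc, ← zpow_add]
  congr 2 <;> [congr 1; skip] <;> push_cast <;> ring_nf

lemma xi'_bseq (m i : ℤ) : xi' m (bseq i) = bseq (2 * i - m) := by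
  rw [bseq, map_mul, map_mul, map_zpow, map_zpow, xi'_bb, xi'_cc, bseq, bseq]
  simp only [← zpow_natCast, ← zpow_mul, mul_assoc, ← zpow_add]
  simp only [← mul_assoc, ← zpow_add]
  congr 2 <;> [congr 1; skip] <;> push_cast <;> ring_nf

/-- Evaluation of the generators in `Θ`. -/
def E (m : ℤ) : FreeGroup P →* Th m :=
  FreeGroup.lift (Sum.elim (fun p => eF m (bseq p.1))
    (fun p => eF m cc ^ (-p.1) * aT m * eF m cc ^ p.1))

lemma bseq_shift (k i : ℤ) : cc ^ k * bseq i * cc ^ (-k) = bseq (i - k) := by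
  rw [bseq, bseq]
  simp only [mul_assoc, ← zpow_add]
  simp only [← mul_assoc, ← zpow_add]
  congr 2 <;> ring_nf

lemma E_act (m k : ℤ) (n : FreeGroup P) :
    E m (act (C ^ k) n) = eF m cc ^ k * E m n * (eF m cc ^ k)⁻¹ := by
  have : (E m).comp (act (C ^ k)).toMonoidHom =
      (MulAut.conj (eF m cc ^ k)).toMonoidHom.comp (E m) := by
    ext p
    rcases p with ⟨x, j⟩ | ⟨x, j⟩
    · simp only [MonoidHom.comp_apply, MulEquiv.coe_toMonoidHom, act_of, (Cpow k x j).1,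
        MulAut.conj_apply]
      simp only [E, FreeGroup.lift_apply_of, Sum.elim_inl]
      rw [← bseq_shift]; simp
    · simp only [MonoidHom.comp_apply, MulEquiv.coe_toMonoidHom, act_of, (Cpow k x j).2,
        MulAut.conj_apply]
      simp only [E, FreeGroup.lift_apply_of, Sum.elim_inr]
      simp only [← zpow_neg, mul_assoc, ← zpow_add]
      simp only [← mul_assoc, ← zpow_add]
      congr 2 <;> ring_nf
  exact DFunLike.congr_fun this n

/-- The set of elements reconstructed by `E`, as a subgroup. -/
def Rec (m : ℤ) : Subgroup (Th m) where
  carrier := {g | ∃ k : ℤ, (fT m g).right = C ^ k ∧ g = E m (fT m g).left * eF m cc ^ k}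
  one_mem' := ⟨0, by simp, by simp⟩
  mul_mem' := by
    rintro g h ⟨k, hk, hg⟩ ⟨l, hl, hh⟩
    refine ⟨k + l, by simp [hk, hl, zpow_add], ?_⟩
    rw [map_mul, SemidirectProduct.mul_left, hk, map_mul, E_act, zpow_add]
    nth_rw 1 [hg, hh]
    group
  inv_mem' := by
    rintro g ⟨k, hk, hg⟩
    refine ⟨-k, by simp [hk], ?_⟩
    rw [map_inv, SemidirectProduct.inv_left, hk, ← zpow_neg, E_act]
    nth_rw 1 [hg]
    rw [map_inv]
    group

lemma G_le (m : ℤ) : Subgroup.closure {aT m, eF m bb, eF m cc} ≤ Rec m := by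
  rw [Subgroup.closure_le]
  rintro x (rfl | rfl | rfl)
  · exact ⟨0, by simp [fT_a], by simp [fT_a, E]⟩
  · exact ⟨0, by simp [fT_e, fF_bb], by simp [fT_e, fF_bb, E, bseq]⟩
  · exact ⟨1, by simp [fT_e, fF_cc], by simp [fT_e, fF_cc]⟩

/-- The invariant subgroup of `W`. -/
def K (T : Set P) : Subgroup W where
  carrier := {w | w.left ∈ Subgroup.closure (FreeGroup.of '' T) ∧
    (∀ p, w.right p ∈ T ↔ p ∈ T) ∧ w.right (Sum.inr (0, 0)) = Sum.inr (0, 0)}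
  one_mem' := ⟨by simp, by simp, by simp⟩
  mul_mem' := by
    rintro g h ⟨g1, g2, g3⟩ ⟨h1, h2, h3⟩
    refine ⟨?_, ?_, by simp [h3, g3]⟩
    · rw [SemidirectProduct.mul_left]
      refine mul_mem g1 ?_
      have : (Subgroup.closure (FreeGroup.of '' T)) ≤
          (Subgroup.closure (FreeGroup.of '' T)).comap (act g.right).toMonoidHom := by
        rw [Subgroup.closure_le]
        rintro _ ⟨p, hp, rfl⟩
        exact Subgroup.subset_closure ⟨g.right p, (g2 p).2 hp, by simp⟩
      exact this h1
    · intro p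
      simp [g2, h2]
  inv_mem' := by
    rintro g ⟨g1, g2, g3⟩
    have g2' : ∀ p, g.right⁻¹ p ∈ T ↔ p ∈ T := fun p => by
      rw [← g2]; simp
    refine ⟨?_, ?_, ?_⟩
    · rw [SemidirectProduct.inv_left]
      have : (Subgroup.closure (FreeGroup.of '' T)) ≤
          (Subgroup.closure (FreeGroup.of '' T)).comap (act g.right⁻¹).toMonoidHom := by
        rw [Subgroup.closure_le]
        rintro _ ⟨p, hp, rfl⟩
        exact Subgroup.subset_closure ⟨g.right⁻¹ p, (g2' p).2 hp, (act_of _ _).symm⟩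
      exact this (inv_mem g1)
    · exact g2'
    · rw [SemidirectProduct.inv_right, Equiv.Perm.inv_eq_iff_eq, g3]

lemma main (m : ℤ) (T : Set P) (X : Set (Th m)) (Y : Set (Th m))
    (hX : ∀ x ∈ X, fT m x ∈ K T) (hY : ∀ p ∈ T, E m (FreeGroup.of p) ∈ Y) :
    Subgroup.closure {aT m, eF m bb, eF m cc} ⊓ Subgroup.closure X ≤ Subgroup.closure Y := by
  rintro g ⟨hg, hx⟩
  obtain ⟨k, hk, he⟩ := G_le m hg
  have hx' : Subgroup.closure X ≤ (K T).comap (fT m) := by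
    rw [Subgroup.closure_le]; exact hX
  obtain ⟨h1, -, h3⟩ := hx' hx
  rw [hk, (Cpow _ _ _).2] at h3
  have hk0 : k = 0 := by simpa using h3
  subst hk0
  rw [he, zpow_zero, mul_one]
  have : Subgroup.closure (FreeGroup.of '' T) ≤ (Subgroup.closure Y).comap (E m) := by
    rw [Subgroup.closure_le]
    rintro _ ⟨p, hp, rfl⟩
    exact Subgroup.subset_closure (hY p hp)
  exact this h1

lemma b_mem_G (m i : ℤ) : eF m (bseq i) ∈ Subgroup.closure {aT m, eF m bb, eF m cc} := by
  have hb : eF m bb ∈ Subgroup.closure {aT m, eF m bb, eF m cc} :=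
    Subgroup.subset_closure (by simp)
  have hc : eF m cc ∈ Subgroup.closure {aT m, eF m bb, eF m cc} :=
    Subgroup.subset_closure (by simp)
  rw [bseq, map_mul, map_mul, map_zpow, map_zpow]
  exact mul_mem (mul_mem (zpow_mem hc _) hb) (zpow_mem hc _)

lemma up (m : ℤ) (S : Subgroup (Th m)) (h : eF m (bseq m) ∈ S) (h1 : T1 m ∈ S) (h2 : T2 m ∈ S) :
    ∀ i : ℤ, m ≤ i → eF m (bseq i) ∈ S := by
  have key : ∀ n : ℕ, eF m (bseq (m + n)) ∈ S := by
    intro n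
    induction n using Nat.strong_induction_on with
    | _ n ih =>
      rcases Nat.even_or_odd' n with ⟨k, rfl | rfl⟩
      · rcases Nat.eq_zero_or_pos k with rfl | hk
        · simpa using h
        · have := T2_conj m (bseq (m + k))
          rw [xi'_bseq] at this
          have e : m + ((2 * k : ℕ) : ℤ) = 2 * (m + k) - m := by push_cast; ring
          rw [e, ← this]
          exact mul_mem (mul_mem (inv_mem h2) (ih k (by omega))) h2
      · have := T1_conj m (bseq (m + k))
        rw [xi_bseq] at this
        have e : m + ((2 * k + 1 : ℕ) : ℤ) = 2 * (m + k) - m + 1 := by push_cast; ring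
        rw [e, ← this]
        exact mul_mem (mul_mem (inv_mem h1) (ih k (by omega))) h1
  intro i hi
  have := key (i - m).toNat
  rwa [Int.toNat_of_nonneg (by omega), add_sub_cancel] at this

lemma down (m : ℤ) (S : Subgroup (Th m)) (h : eF m (bseq (m - 1)) ∈ S) (h1 : T1 m ∈ S)
    (h2 : T2 m ∈ S) : ∀ i : ℤ, i ≤ m - 1 → eF m (bseq i) ∈ S := by
  have key : ∀ n : ℕ, eF m (bseq (m - 1 - n)) ∈ S := by
    intro n
    induction n using Nat.strong_induction_on with
    | _ n ih =>
      rcases Nat.even_or_odd' n with ⟨k, rfl | rfl⟩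
      · rcases Nat.eq_zero_or_pos k with rfl | hk
        · simpa using h
        · have := T1_conj m (bseq (m - 1 - k))
          rw [xi_bseq] at this
          have e : m - 1 - ((2 * k : ℕ) : ℤ) = 2 * (m - 1 - k) - m + 1 := by push_cast; ring
          rw [e, ← this]
          exact mul_mem (mul_mem (inv_mem h1) (ih k (by omega))) h1
      · have := T2_conj m (bseq (m - 1 - k))
        rw [xi'_bseq] at this
        have e : m - 1 - ((2 * k + 1 : ℕ) : ℤ) = 2 * (m - 1 - k) - m := by push_cast; ring
        rw [e, ← this]
        exact mul_mem (mul_mem (inv_mem h2) (ih k (by omega))) h2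
  intro i hi
  have := key (m - 1 - i).toNat
  rwa [Int.toNat_of_nonneg (by omega), sub_sub_cancel] at this

/-- The invariant sets: `Q` describes the `b`-part, `A` tells whether `a` is included. -/
def TT (Q : ℤ → Prop) (A : Prop) : Set P :=
  {p | Sum.elim (fun q => Q q.1) (fun q => A ∧ q = (0, 0)) p}

lemma inl_mem (T : Set P) (p : P) (hp : p ∈ T) :
    (SemidirectProduct.inl (FreeGroup.of p) : W) ∈ K T :=
  ⟨Subgroup.subset_closure ⟨p, hp, rfl⟩, by simp, by simp⟩

lemma U1_mem (m : ℤ) (Q : ℤ → Prop) (A : Prop)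
    (hQ : ∀ x s : ℤ, 0 ≤ s → s ≤ 1 → (Q (2 * x - m + s) ↔ Q x)) :
    (SemidirectProduct.inr (U1 m) : W)⁻¹ ∈ K (TT Q A) := by
  refine inv_mem ⟨by simp, ?_, ?_⟩
  · rintro (⟨x, j⟩ | ⟨x, j⟩)
    · simp only [SemidirectProduct.right_inr, U1_inl, TT, Set.mem_ofPred_eq, Sum.elim_inl]
      rw [← hQ x (1 - j % 2) (by omega) (by omega)]
      ring_nf
    · simp only [SemidirectProduct.right_inr, U1_inr, TT, Set.mem_ofPred_eq, Sum.elim_inr,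
        Prod.mk.injEq]
      refine and_congr_right fun _ => ?_
      omega
  · simp

lemma U2_mem (m : ℤ) (Q : ℤ → Prop) (A : Prop)
    (hQ : ∀ x s : ℤ, 0 ≤ s → s ≤ 1 → (Q (2 * x - m + s) ↔ Q x)) :
    (SemidirectProduct.inr (U2 m) : W)⁻¹ ∈ K (TT Q A) := by
  refine inv_mem ⟨by simp, ?_, ?_⟩
  · rintro (⟨x, j⟩ | ⟨x, j⟩)
    · simp only [SemidirectProduct.right_inr, U2_inl, TT, Set.mem_ofPred_eq, Sum.elim_inl]
      rw [← hQ x (j % 2) (by omega) (by omega)]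
    · simp only [SemidirectProduct.right_inr, U2_inr, TT, Set.mem_ofPred_eq, Sum.elim_inr,
        Prod.mk.injEq]
      refine and_congr_right fun _ => ?_
      omega
  · simp

lemma part1 (m r : ℤ) (Q : ℤ → Prop) (hr : Q r)
    (hQ : ∀ x s : ℤ, 0 ≤ s → s ≤ 1 → (Q (2 * x - m + s) ↔ Q x))
    (gen : ∀ S : Subgroup (Th m), eF m (bseq r) ∈ S → T1 m ∈ S → T2 m ∈ S →
      ∀ i : ℤ, Q i → eF m (bseq i) ∈ S) :
    Subgroup.closure {aT m, eF m bb, eF m cc} ⊓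
        Subgroup.closure {eF m (bseq r), T1 m, T2 m} =
      Subgroup.closure {x | ∃ i : ℤ, Q i ∧ x = eF m (bseq i)} := by
  apply le_antisymm
  · apply main m (TT Q False)
    · rintro x (rfl | rfl | rfl)
      · rw [fT_e, fF_bseq]; exact inl_mem _ _ hr
      · rw [fT_1]; exact U1_mem m Q _ hQ
      · rw [fT_2]; exact U2_mem m Q _ hQ
    · rintro (p | p) hp
      · exact ⟨p.1, hp, by simp [E]⟩
      · exact hp.1.elim
  · rw [Subgroup.closure_le]
    rintro _ ⟨i, hi, rfl⟩
    refine ⟨b_mem_G m i, gen _ ?_ ?_ ?_ i hi⟩ <;> exact Subgroup.subset_closure (by simp)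

lemma part2 (m r : ℤ) (Q : ℤ → Prop) (hr : Q r)
    (hQ : ∀ x s : ℤ, 0 ≤ s → s ≤ 1 → (Q (2 * x - m + s) ↔ Q x))
    (gen : ∀ S : Subgroup (Th m), eF m (bseq r) ∈ S → T1 m ∈ S → T2 m ∈ S →
      ∀ i : ℤ, Q i → eF m (bseq i) ∈ S) :
    Subgroup.closure {aT m, eF m bb, eF m cc} ⊓
        Subgroup.closure {aT m, eF m (bseq r), T1 m, T2 m} =
      Subgroup.closure ({aT m} ∪ {x | ∃ i : ℤ, Q i ∧ x = eF m (bseq i)}) := by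
  apply le_antisymm
  · apply main m (TT Q True)
    · rintro x (rfl | rfl | rfl | rfl)
      · rw [fT_a]; exact inl_mem _ _ ⟨trivial, rfl⟩
      · rw [fT_e, fF_bseq]; exact inl_mem _ _ hr
      · rw [fT_1]; exact U1_mem m Q _ hQ
      · rw [fT_2]; exact U2_mem m Q _ hQ
    · rintro (p | p) hp
      · exact Or.inr ⟨p.1, hp, by simp [E]⟩
      · obtain ⟨-, rfl⟩ := hp
        left
        simp [E]
  · rw [Subgroup.closure_le]
    rintro _ (rfl | ⟨i, hi, rfl⟩)
    · exact ⟨Subgroup.subset_closure (by simp), Subgroup.subset_closure (by simp)⟩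
    · refine ⟨b_mem_G m i, gen _ ?_ ?_ ?_ i hi⟩ <;> exact Subgroup.subset_closure (by simp)

end Stmt17

theorem stmt17 (m : ℤ)
    (hxi : Function.Injective (xi m)) (hxi' : Function.Injective (xi' m)) :
    -- in `Θ = ⟨a⟩ * Ξ_m`, with `a` the generator of the infinite cyclic free factor,
    -- `emb : F →* Θ` the canonical embedding of `F`, `G = ⟨a, b, c⟩ ≤ Θ`, and
    -- `T₁, T₂` the images of the stable letters `t_m, t'_m`:
    ∀ emb : FreeGroup (Fin 2) →* Coprod (FreeGroup Unit) (HNN2 (xi m) (xi' m)),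
      emb = Coprod.inr.comp (HNN2.of (xi m) (xi' m)) →
    ∀ a : Coprod (FreeGroup Unit) (HNN2 (xi m) (xi' m)),
      a = Coprod.inl (FreeGroup.of ()) →
    ∀ T₁ T₂ : Coprod (FreeGroup Unit) (HNN2 (xi m) (xi' m)),
      T₁ = Coprod.inr (HNN2.t₁ (xi m) (xi' m)) → T₂ = Coprod.inr (HNN2.t₂ (xi m) (xi' m)) →
    -- `G ∩ ⟨b_m, t_m, t'_m⟩ = ⟨b_m, b_{m+1}, …⟩`:
    (Subgroup.closure {a, emb bb, emb cc} ⊓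
        Subgroup.closure {emb (bseq m), T₁, T₂} =
      Subgroup.closure {x | ∃ i : ℤ, m ≤ i ∧ x = emb (bseq i)}) ∧
    -- `G ∩ ⟨a, b_m, t_m, t'_m⟩ = ⟨a, b_m, b_{m+1}, …⟩`:
    (Subgroup.closure {a, emb bb, emb cc} ⊓
        Subgroup.closure {a, emb (bseq m), T₁, T₂} =
      Subgroup.closure ({a} ∪ {x | ∃ i : ℤ, m ≤ i ∧ x = emb (bseq i)})) ∧
    -- `G ∩ ⟨b_{m-1}, t_m, t'_m⟩ = ⟨b_{m-1}, b_{m-2}, …⟩`: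
    (Subgroup.closure {a, emb bb, emb cc} ⊓
        Subgroup.closure {emb (bseq (m - 1)), T₁, T₂} =
      Subgroup.closure {x | ∃ i : ℤ, i ≤ m - 1 ∧ x = emb (bseq i)}) ∧
    -- `G ∩ ⟨a, b_{m-1}, t_m, t'_m⟩ = ⟨a, b_{m-1}, b_{m-2}, …⟩`:
    (Subgroup.closure {a, emb bb, emb cc} ⊓
        Subgroup.closure {a, emb (bseq (m - 1)), T₁, T₂} =
      Subgroup.closure ({a} ∪ {x | ∃ i : ℤ, i ≤ m - 1 ∧ x = emb (bseq i)})) := by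
  rintro _ rfl _ rfl _ _ rfl rfl
  refine ⟨?_, ?_, ?_, ?_⟩
  · exact Stmt17.part1 m m (fun i => m ≤ i) le_rfl (by intros; omega) (Stmt17.up m)
  · exact Stmt17.part2 m m (fun i => m ≤ i) le_rfl (by intros; omega) (Stmt17.up m)
  · exact Stmt17.part1 m (m - 1) (fun i => i ≤ m - 1) le_rfl (by intros; omega) (Stmt17.down m)
  · exact Stmt17.part2 m (m - 1) (fun i => i ≤ m - 1) le_rfl (by intros; omega) (Stmt17.down m)
end
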